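/- arXiv:math/0703178 — 3 statements merged into one kernel-verified Lean document; each statement's English description precedes it below -/
import Mathlib

section
/- Let Q be an extended Dynkin quiver which is not an oriented cycle, k a finite field, and X a regular kQ-module which is either homogeneous or lies in a single non-homogeneous tube. Let M be an indecomposable preinjective module with defect ∂(M) = 1 and dimension vector dim M > δ, and let N be an indecomposable preprojective module with defect ∂(N) = −1. Let M' be the (unique up to isomorphism) indecomposable module with dimension vector dim M − δ and N' the (unique up to isomorphism) indecomposable module with dimension vector dim N + δ. Then F_{MN}^X = F_{M'N'}^X. -/
open Polynomial

/-- A finite quiver, given by a finite set of vertices, a finite set of arrows,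
and source/target maps. -/
structure QuiverData where
  V : Type
  A : Type
  [fintV : Fintype V]
  [decV : DecidableEq V]
  [fintA : Fintype A]
  s : A → V
  t : A → V

attribute [instance] QuiverData.fintV QuiverData.decV QuiverData.fintA

/-- A representation of a quiver over a field `k`:  a finite dimensional vector
space at each vertex together with a linear map for each arrow.  This is the same
thing as a `kQ`-module (finite dimensionality is imposed separately via `FinDim`). -/
structure Repn (k : Type) [Field k] (Q : QuiverData) where
  space : Q.V → Type
  [addcg : ∀ v, AddCommGroup (space v)]
  [mod : ∀ v, Module k (space v)]
  map : ∀ a : Q.A, space (Q.s a) →ₗ[k] space (Q.t a)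

attribute [instance] Repn.addcg Repn.mod

namespace Repn

variable {k : Type} [Field k] {Q : QuiverData}

/-- An isomorphism of representations. -/
structure Iso (M N : Repn k Q) where
  e : ∀ v, M.space v ≃ₗ[k] N.space v
  comm : ∀ (a : Q.A) (x : M.space (Q.s a)), e (Q.t a) (M.map a x) = N.map a (e (Q.s a) x)

/-- Direct sum of two representations. -/
def dsum (M N : Repn k Q) : Repn k Q where
  space v := M.space v × N.space v
  map a := (M.map a).prodMap (N.map a)

/-- Direct sum of a family of representations. -/
def dsumFam {ι : Type} (X : ι → Repn k Q) : Repn k Q where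
  space v := ∀ i, (X i).space v
  map a := LinearMap.pi fun i => ((X i).map a).comp (LinearMap.proj i)

/-- The zero representation(s). -/
def IsZero (M : Repn k Q) : Prop := ∀ (v : Q.V) (x : M.space v), x = 0

/-- Pointwise finite dimensionality, i.e. `M` is a finite `kQ`-module. -/
def FinDim (M : Repn k Q) : Prop := ∀ v, FiniteDimensional k (M.space v)

/-- Indecomposability. -/
def Indec (M : Repn k Q) : Prop :=
  ¬ M.IsZero ∧ ∀ Y Z : Repn k Q, Nonempty (Iso M (Y.dsum Z)) → Y.IsZero ∨ Z.IsZero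

/-- The dimension vector. -/
noncomputable def dimv (M : Repn k Q) : Q.V → ℕ := fun v => Module.finrank k (M.space v)

end Repn

/-- A subrepresentation of `X`, i.e. a `kQ`-submodule. -/
structure Subrep {k : Type} [Field k] {Q : QuiverData} (X : Repn k Q) where
  sub : ∀ v, Submodule k (X.space v)
  stable : ∀ a : Q.A, (sub (Q.s a)).map (X.map a) ≤ sub (Q.t a)

namespace Subrep

variable {k : Type} [Field k] {Q : QuiverData} {X : Repn k Q}

/-- A subrepresentation as a representation. -/
def repn (U : Subrep X) : Repn k Q where
  space v := U.sub v
  map a := (X.map a).restrict fun _ hx => U.stable a (Submodule.mem_map_of_mem hx)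

/-- The quotient representation `X/U`. -/
def quot (U : Subrep X) : Repn k Q where
  space v := X.space v ⧸ U.sub v
  map a := Submodule.mapQ (U.sub (Q.s a)) (U.sub (Q.t a)) (X.map a)
    (Submodule.map_le_iff_le_comap.mp (U.stable a))

end Subrep

/-- The Hall number `F_{MN}^X`: the number of subrepresentations `U ≤ X` with
`U ≅ N` and `X/U ≅ M`. -/
noncomputable def hallNum {k : Type} [Field k] {Q : QuiverData} (M N X : Repn k Q) : ℕ :=
  Nat.card {U : Subrep X // Nonempty (Repn.Iso U.repn N) ∧ Nonempty (Repn.Iso U.quot M)}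

/-- The number of automorphisms of a representation. -/
noncomputable def autCard {k : Type} [Field k] {Q : QuiverData} (M : Repn k Q) : ℕ :=
  Nat.card (Repn.Iso M M)

/-- The Euler form of the quiver `Q`. -/
def eulerZ (Q : QuiverData) (d e : Q.V → ℤ) : ℤ :=
  (∑ v, d v * e v) - ∑ a, d (Q.s a) * e (Q.t a)

/-- The Tits quadratic form of `Q`. -/
def titsZ (Q : QuiverData) (d : Q.V → ℤ) : ℤ := eulerZ Q d d

/-- Coercion of a dimension vector to an integral vector. -/
def natc {Q : QuiverData} (d : Q.V → ℕ) : Q.V → ℤ := fun v => (d v : ℤ)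

/-- Connectedness of the underlying graph of `Q`. -/
def QuiverData.Connected (Q : QuiverData) : Prop :=
  ∀ u v : Q.V, Relation.ReflTransGen
    (fun x y => ∃ a, (Q.s a = x ∧ Q.t a = y) ∨ (Q.s a = y ∧ Q.t a = x)) u v

/-- `Q` is a Dynkin quiver iff it is connected and its Tits form is positive definite. -/
def IsDynkin (Q : QuiverData) : Prop :=
  Q.Connected ∧ ∀ d : Q.V → ℤ, d ≠ 0 → 0 < titsZ Q d

/-- `Q` is an extended Dynkin (affine) quiver iff it is connected and its Tits form is
positive semidefinite but not definite. -/
def IsAffine (Q : QuiverData) : Prop :=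
  Q.Connected ∧ (∀ d : Q.V → ℤ, 0 ≤ titsZ Q d) ∧ ∃ d : Q.V → ℤ, d ≠ 0 ∧ titsZ Q d = 0

/-- `δ` is the minimal positive imaginary root of the affine quiver `Q`. -/
def IsMinImagRoot (Q : QuiverData) (δ : Q.V → ℕ) : Prop :=
  δ ≠ 0 ∧ titsZ Q (natc δ) = 0 ∧
    ∀ d : Q.V → ℕ, d ≠ 0 → titsZ Q (natc d) = 0 → ∀ v, δ v ≤ d v

/-- `Q` is an oriented cycle iff every vertex has exactly one incoming and one
outgoing arrow (`Q` being connected). -/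
def IsOrientedCycle (Q : QuiverData) : Prop :=
  ∀ v : Q.V, Nat.card {a : Q.A // Q.s a = v} = 1 ∧ Nat.card {a : Q.A // Q.t a = v} = 1

/-- The standard map whose kernel is `Hom(M,N)` and whose cokernel is `Ext¹(M,N)`. -/
noncomputable def extMap {k : Type} [Field k] {Q : QuiverData} (M N : Repn k Q) :
    (∀ v, M.space v →ₗ[k] N.space v) →ₗ[k] (∀ a : Q.A, M.space (Q.s a) →ₗ[k] N.space (Q.t a)) :=
  LinearMap.pi fun a =>
    ((LinearMap.llcomp k (M.space (Q.s a)) (N.space (Q.s a)) (N.space (Q.t a)) (N.map a)).comp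
        (LinearMap.proj (Q.s a)))
      - ((LinearMap.lcomp k (N.space (Q.t a)) (M.map a)).comp (LinearMap.proj (Q.t a)))

/-- `dim_k Hom(M,N)`. -/
noncomputable def homDim {k : Type} [Field k] {Q : QuiverData} (M N : Repn k Q) : ℕ :=
  Module.finrank k (LinearMap.ker (extMap M N))

/-- `dim_k Ext¹(M,N)`. -/
noncomputable def extDim {k : Type} [Field k] {Q : QuiverData} (M N : Repn k Q) : ℕ :=
  Module.finrank k
    ((∀ a : Q.A, M.space (Q.s a) →ₗ[k] N.space (Q.t a)) ⧸ LinearMap.range (extMap M N))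

section Affine

variable {k : Type} [Field k] {Q : QuiverData}

/-- The defect `∂(d) = ⟨δ, d⟩`. -/
def defectOf (Q : QuiverData) (δ : Q.V → ℕ) (d : Q.V → ℤ) : ℤ := eulerZ Q (natc δ) d

/-- An indecomposable preprojective module (negative defect). -/
def IsPreprojIndec (δ : Q.V → ℕ) (M : Repn k Q) : Prop :=
  M.Indec ∧ M.FinDim ∧ defectOf Q δ (natc (Repn.dimv M)) < 0

/-- An indecomposable preinjective module (positive defect). -/
def IsPreinjIndec (δ : Q.V → ℕ) (M : Repn k Q) : Prop :=
  M.Indec ∧ M.FinDim ∧ 0 < defectOf Q δ (natc (Repn.dimv M))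

/-- An indecomposable regular module (zero defect). -/
def IsRegIndec (δ : Q.V → ℕ) (M : Repn k Q) : Prop :=
  M.Indec ∧ M.FinDim ∧ defectOf Q δ (natc (Repn.dimv M)) = 0

/-- Two indecomposable regular modules lie in the same tube iff they are connected by a
chain of nonzero homomorphisms among indecomposable regular modules. -/
def SameTube (δ : Q.V → ℕ) (X Y : Repn k Q) : Prop :=
  Relation.EqvGen
    (fun M N => IsRegIndec δ M ∧ IsRegIndec δ N ∧ (homDim M N ≠ 0 ∨ homDim N M ≠ 0)) X Y

/-- An indecomposable regular module lies in a homogeneous tube iff the dimension vector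
of every indecomposable in its tube is a multiple of `δ`. -/
def InHomogTube (δ : Q.V → ℕ) (X : Repn k Q) : Prop :=
  IsRegIndec δ X ∧
    ∀ Y : Repn k Q, IsRegIndec δ Y → SameTube δ X Y → ∃ m : ℕ, ∀ v, Repn.dimv Y v = m * δ v

/-- `M` decomposes as a finite direct sum of modules satisfying `P`. -/
def DecompInto (P : Repn k Q → Prop) (M : Repn k Q) : Prop :=
  ∃ (ι : Type) (_ : Fintype ι) (Xi : ι → Repn k Q),
    (∀ i, P (Xi i)) ∧ Nonempty (Repn.Iso M (Repn.dsumFam Xi))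

/-- A regular module: a direct sum of indecomposable regular modules. -/
def IsRegularModule (δ : Q.V → ℕ) (M : Repn k Q) : Prop :=
  DecompInto (IsRegIndec δ) M

/-- A homogeneous regular module: all indecomposable summands lie in homogeneous tubes. -/
def IsHomogRegular (δ : Q.V → ℕ) (M : Repn k Q) : Prop :=
  DecompInto (InHomogTube δ) M

/-- A regular module lying in a single non-homogeneous tube. -/
def SingleNonHomogTube (δ : Q.V → ℕ) (M : Repn k Q) : Prop :=
  ∃ (ι : Type) (_ : Fintype ι) (Xi : ι → Repn k Q),
    (∀ i, IsRegIndec δ (Xi i) ∧ ¬ InHomogTube δ (Xi i)) ∧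
    (∀ i j, SameTube δ (Xi i) (Xi j)) ∧
    Nonempty (Repn.Iso M (Repn.dsumFam Xi))

/-- A regular subobject: a subrepresentation which is regular with regular quotient. -/
def IsRegSub (δ : Q.V → ℕ) {X : Repn k Q} (U : Subrep X) : Prop :=
  IsRegularModule δ U.repn ∧ IsRegularModule δ U.quot

/-- A regular simple (quasi-simple) module: a simple object of the abelian category of
regular modules. -/
def IsRegSimple (δ : Q.V → ℕ) (X : Repn k Q) : Prop :=
  IsRegIndec δ X ∧
    ∀ U : Subrep X, IsRegSub δ U → (U.repn).IsZero ∨ (U.quot).IsZero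

/-- `X` has a filtration by `ℓ` regular simples (i.e. `X` is regular of quasi-length `ℓ`). -/
def HasRegFilt (δ : Q.V → ℕ) : ℕ → Repn k Q → Prop
  | 0, X => X.IsZero
  | (ℓ+1), X => ∃ U : Subrep X,
      IsRegSimple δ U.quot ∧ IsRegularModule δ U.repn ∧ HasRegFilt δ ℓ U.repn

/-- The regular socle of `X` has dimension vector `d`. -/
def QuasiSocleDim (δ : Q.V → ℕ) (X : Repn k Q) (d : Q.V → ℕ) : Prop :=
  ∃ U : Subrep X, IsRegSimple δ U.repn ∧ IsRegularModule δ U.quot ∧ Repn.dimv U.repn = d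

/-- `X` is the indecomposable module (containing no homogeneous regular summand)
specified by the combinatorial symbol `p = (d, ℓ)`:  if `∂(d) ≠ 0` then `X` is the
unique indecomposable (preprojective or preinjective) of dimension vector `d` (and
`ℓ = 1`); if `∂(d) = 0` then `X` is the indecomposable in a non-homogeneous tube with
regular socle of dimension vector `d` and quasi-length `ℓ`. -/
def RealizesIndecSymbol (δ : Q.V → ℕ) (X : Repn k Q) (p : (Q.V → ℕ) × ℕ) : Prop :=
  X.Indec ∧ X.FinDim ∧ ¬ InHomogTube δ X ∧
    ((defectOf Q δ (natc p.1) ≠ 0 ∧ p.2 = 1 ∧ Repn.dimv X = p.1) ∨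
     (defectOf Q δ (natc p.1) = 0 ∧ QuasiSocleDim δ X p.1 ∧ HasRegFilt δ p.2 X))

/-- `X` is a direct summand of `R`. -/
def SummandOf (X R : Repn k Q) : Prop :=
  ∃ Z : Repn k Q, Nonempty (Repn.Iso R (X.dsum Z))

/-- `R` is the homogeneous regular module `R(λ,x)` for some point `x` of degree `d`,
where `p = (λ, d)`:  a direct sum, over the parts `c` of `λ`, of indecomposables of
quasi-length `c` all lying in one homogeneous tube whose quasi-simple has dimension
vector `d·δ`. -/
def RealizesHomogPair (δ : Q.V → ℕ) (R : Repn k Q) (p : Multiset ℕ+ × ℕ+) : Prop :=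
  ∃ (ι : Type) (hι : Fintype ι) (Xi : ι → Repn k Q) (len : ι → ℕ+),
    (∀ i, InHomogTube δ (Xi i) ∧
      QuasiSocleDim δ (Xi i) (fun v => (p.2 : ℕ) * δ v) ∧
      HasRegFilt δ (len i : ℕ) (Xi i)) ∧
    (∀ i j, SameTube δ (Xi i) (Xi j)) ∧
    Multiset.map len hι.elems.val = p.1 ∧
    Nonempty (Repn.Iso R (Repn.dsumFam Xi))

/-- No indecomposable regular summand of `R` shares a tube with one of `R'`. -/
def TubeDisjoint (δ : Q.V → ℕ) (R R' : Repn k Q) : Prop :=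
  ∀ X Y : Repn k Q, SummandOf X R → SummandOf Y R' →
    IsRegIndec δ X → IsRegIndec δ Y → ¬ SameTube δ X Y

end Affine

/-- A decomposition symbol `α = (μ, σ)` (Bongartz–Dudek):  `μ` is a multiset of
combinatorial symbols specifying a module without homogeneous regular summands, and
`σ` is a Segre symbol, i.e. a multiset of pairs (partition, degree). -/
def DSymb (Q : QuiverData) : Type :=
  Multiset ((Q.V → ℕ) × ℕ) × Multiset (Multiset ℕ+ × ℕ+)

section Classes

variable {k : Type} [Field k] {Q : QuiverData}

/-- `M` lies in the decomposition class `S(α,k)`:  `M ≅ M(μ,k) ⊕ R(λ_1,x_1) ⊕ ⋯ ⊕ R(λ_r,x_r)`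
where `M(μ,k)` is the module without homogeneous regular summands specified by `μ = α.1`
and the `x_i` are points lying in pairwise distinct homogeneous tubes, with partitions
and degrees prescribed by the Segre symbol `α.2`. -/
def InDecompClass (δ : Q.V → ℕ) (α : DSymb Q) (M : Repn k Q) : Prop :=
  ∃ D R : Repn k Q, Nonempty (Repn.Iso M (D.dsum R)) ∧
    (∃ (ι : Type) (hι : Fintype ι) (Xi : ι → Repn k Q) (tag : ι → (Q.V → ℕ) × ℕ),
      (∀ i, RealizesIndecSymbol δ (Xi i) (tag i)) ∧
      Multiset.map tag hι.elems.val = α.1 ∧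
      Nonempty (Repn.Iso D (Repn.dsumFam Xi))) ∧
    (∃ (κ : Type) (hκ : Fintype κ) (Rj : κ → Repn k Q) (ptag : κ → Multiset ℕ+ × ℕ+),
      (∀ j, RealizesHomogPair δ (Rj j) (ptag j)) ∧
      (∀ j j', j ≠ j' → TubeDisjoint δ (Rj j) (Rj j')) ∧
      Multiset.map ptag hκ.elems.val = α.2 ∧
      Nonempty (Repn.Iso R (Repn.dsumFam Rj)))

/-- The number of isomorphism classes of representations satisfying `P`. -/
noncomputable def classCount (P : Repn k Q → Prop) : ℕ :=
  Nat.card (Quot (fun (M N : {M : Repn k Q // P M}) => Nonempty (Repn.Iso M.1 N.1)))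

/-- `Σ_{A ∈ S(α,k), B ∈ S(β,k)} F_{AB}^C`: the number of subrepresentations `U ≤ C`
with `U` in the class `β` and `C/U` in the class `α`. -/
noncomputable def pairHallSum (αP βP : Repn k Q → Prop) (C : Repn k Q) : ℕ :=
  Nat.card {U : Subrep C // βP U.repn ∧ αP U.quot}

/-- `Σ_{B ∈ S(β,k), C ∈ S(γ,k)} F_{AB}^C` for a fixed module `A`:  the sum over the
isomorphism classes `C` in `S(γ,k)` of the number of `U ≤ C` with `U ∈ S(β,k)` and
`C/U ≅ A`. -/
noncomputable def hallSumFixedQuot (γP βP : Repn k Q → Prop) (A : Repn k Q) : ℕ :=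
  Nat.card (Σ c : Quot (fun (M N : {M : Repn k Q // γP M}) => Nonempty (Repn.Iso M.1 N.1)),
    {U : Subrep (c.out.1) // βP U.repn ∧ Nonempty (Repn.Iso U.quot A)})

/-- `Σ_{A ∈ S(α,k), C ∈ S(γ,k)} F_{AB}^C` for a fixed module `B`. -/
noncomputable def hallSumFixedSub (γP αP : Repn k Q → Prop) (B : Repn k Q) : ℕ :=
  Nat.card (Σ c : Quot (fun (M N : {M : Repn k Q // γP M}) => Nonempty (Repn.Iso M.1 N.1)),
    {U : Subrep (c.out.1) // Nonempty (Repn.Iso U.repn B) ∧ αP U.quot})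

end Classes

/-- `F` is a Hall polynomial for the decomposition symbols `(α, β; γ)`:  for every
finite field `k` with `q` elements,
`F(q) = Σ_{A ∈ S(α,k), B ∈ S(β,k)} F_{AB}^C` for all `C ∈ S(γ,k)`,
`n_γ(q)F(q) = n_α(q) Σ_{B ∈ S(β,k), C ∈ S(γ,k)} F_{AB}^C` for all `A ∈ S(α,k)`, and
`n_γ(q)F(q) = n_β(q) Σ_{A ∈ S(α,k), C ∈ S(γ,k)} F_{AB}^C` for all `B ∈ S(β,k)`,
where `n_α(q) = |S(α,k)|`. -/
def IsHallPoly (Q : QuiverData) (δ : Q.V → ℕ) (α β γ : DSymb Q) (F : Polynomial ℚ) : Prop :=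
  ∀ (k : Type) [Field k] [Fintype k],
    (∀ C : Repn k Q, InDecompClass δ γ C →
      (pairHallSum (InDecompClass δ α) (InDecompClass δ β) C : ℚ)
        = F.eval ((Fintype.card k : ℚ))) ∧
    (∀ A : Repn k Q, InDecompClass δ α A →
      (classCount (fun M : Repn k Q => InDecompClass δ γ M) : ℚ) * F.eval ((Fintype.card k : ℚ))
        = (classCount (fun M : Repn k Q => InDecompClass δ α M) : ℚ) *
            (hallSumFixedQuot (InDecompClass δ γ) (InDecompClass δ β) A : ℚ)) ∧
    (∀ B : Repn k Q, InDecompClass δ β B →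
      (classCount (fun M : Repn k Q => InDecompClass δ γ M) : ℚ) * F.eval ((Fintype.card k : ℚ))
        = (classCount (fun M : Repn k Q => InDecompClass δ β M) : ℚ) *
            (hallSumFixedSub (InDecompClass δ γ) (InDecompClass δ α) B : ℚ))

/-- The Hall polynomial for `(α, β; γ)` exists. -/
def HallPolyExists (Q : QuiverData) (δ : Q.V → ℕ) (α β γ : DSymb Q) : Prop :=
  ∃ F : Polynomial ℚ, IsHallPoly Q δ α β γ F

namespace HallShift

variable {k : Type} [Field k] {Q : QuiverData}

/-- Homomorphisms of representations. -/
structure RHom (M N : Repn k Q) where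
  f : ∀ v, M.space v →ₗ[k] N.space v
  comm : ∀ a x, f (Q.t a) (M.map a x) = N.map a (f (Q.s a) x)

theorem RHom.ext' {M N : Repn k Q} {g h : RHom M N} (e : ∀ v x, g.f v x = h.f v x) : g = h := by
  cases g; cases h
  congr
  funext v
  exact LinearMap.ext (e v)

theorem extMap_apply (M N : Repn k Q) (φ : ∀ v, M.space v →ₗ[k] N.space v) (a : Q.A) :
    extMap M N φ a = (N.map a).comp (φ (Q.s a)) - (φ (Q.t a)).comp (M.map a) := by
  ext x
  simp [extMap]

theorem extMap_apply' (M N : Repn k Q) (φ : ∀ v, M.space v →ₗ[k] N.space v) (a : Q.A)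
    (x : M.space (Q.s a)) :
    extMap M N φ a x = N.map a (φ (Q.s a) x) - φ (Q.t a) (M.map a x) := by
  simp [extMap_apply]

/-- `Hom(M,N)` as the kernel of the standard map. -/
def homEquiv (M N : Repn k Q) : RHom M N ≃ LinearMap.ker (extMap M N) where
  toFun g := ⟨g.f, by
    rw [LinearMap.mem_ker]
    funext a
    ext x
    rw [extMap_apply', g.comm]
    simp⟩
  invFun φ := ⟨φ.1, fun a x => by
    have h := LinearMap.mem_ker.1 φ.2
    have h2 : extMap M N φ.1 a x = 0 := by rw [h]; rfl
    rw [extMap_apply'] at h2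
    exact (sub_eq_zero.1 h2).symm⟩
  left_inv g := rfl
  right_inv φ := rfl

/-- Finite dimensional representations, as a class. -/
class FD (M : Repn k Q) : Prop where
  fd : ∀ v, FiniteDimensional k (M.space v)

instance (M : Repn k Q) [h : FD M] (v : Q.V) : FiniteDimensional k (M.space v) := h.fd v

instance {M : Repn k Q} [FD M] (U : Subrep M) : FD U.repn :=
  ⟨fun v => inferInstanceAs (FiniteDimensional k (U.sub v))⟩

instance {M : Repn k Q} [FD M] (U : Subrep M) : FD U.quot :=
  ⟨fun v => inferInstanceAs (FiniteDimensional k (M.space v ⧸ U.sub v))⟩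

theorem euler_form (M N : Repn k Q) [FD M] [FD N] :
    (homDim M N : ℤ) - extDim M N = eulerZ Q (natc M.dimv) (natc N.dimv) := by
  have h1 := LinearMap.finrank_range_add_finrank_ker (extMap M N)
  have h2 := Submodule.finrank_quotient_add_finrank (LinearMap.range (extMap M N))
  have h3 : Module.finrank k (∀ v, M.space v →ₗ[k] N.space v) = ∑ v, M.dimv v * N.dimv v := by
    rw [Module.finrank_pi_fintype]
    exact Finset.sum_congr rfl fun v _ => Module.finrank_linearMap ..
  have h4 : Module.finrank k (∀ a : Q.A, M.space (Q.s a) →ₗ[k] N.space (Q.t a))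
      = ∑ a, M.dimv (Q.s a) * N.dimv (Q.t a) := by
    rw [Module.finrank_pi_fintype]
    exact Finset.sum_congr rfl fun v _ => Module.finrank_linearMap ..
  rw [h3] at h1
  rw [h4] at h2
  unfold homDim extDim eulerZ natc
  zify at h1 h2
  linarith

/-- Vanishing of `Ext¹`. -/
def ExtZero (M N : Repn k Q) : Prop := Function.Surjective (extMap M N)

theorem extZero_iff (M N : Repn k Q) [FD M] [FD N] : ExtZero M N ↔ extDim M N = 0 := by
  unfold ExtZero extDim
  rw [Module.finrank_zero_iff, Submodule.Quotient.subsingleton_iff,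
    LinearMap.range_eq_top]

theorem extZero_sub {A M J : Repn k Q} (i : RHom A M) (hi : ∀ v, Function.Injective (i.f v))
    (h : ExtZero M J) : ExtZero A J := by
  intro g
  choose r hr using fun v => LinearMap.exists_leftInverse_of_injective (i.f v)
    (LinearMap.ker_eq_bot.2 (hi v))
  obtain ⟨φ, hφ⟩ := h (fun a => (g a).comp (r (Q.s a)))
  refine ⟨fun v => (φ v).comp (i.f v), ?_⟩
  funext a
  ext x
  have h1 : extMap M J φ a (i.f _ x) = g a (r _ (i.f _ x)) := by rw [hφ]; rfl
  have h2 : r _ (i.f _ x) = x := LinearMap.congr_fun (hr (Q.s a)) x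
  rw [extMap_apply', h2, ← i.comm] at h1
  rw [extMap_apply', ← h1]
  rfl

theorem extZero_quot {P Y B : Repn k Q} (p : RHom Y B) (hp : ∀ v, Function.Surjective (p.f v))
    (h : ExtZero P Y) : ExtZero P B := by
  intro g
  choose r hr using fun v => LinearMap.exists_rightInverse_of_surjective (p.f v)
    (LinearMap.range_eq_top.2 (hp v))
  obtain ⟨φ, hφ⟩ := h (fun a => (r (Q.t a)).comp (g a))
  refine ⟨fun v => (p.f v).comp (φ v), ?_⟩
  funext a
  ext x
  have h1 : extMap P Y φ a x = r _ (g a x) := by rw [hφ]; rfl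
  have h2 : p.f _ (r _ (g a x)) = g a x := LinearMap.congr_fun (hr (Q.t a)) _
  rw [extMap_apply'] at h1
  rw [extMap_apply', ← h2, ← h1, map_sub, p.comm]
  rfl

theorem extZero_mid_right {P K J B : Repn k Q} (i : RHom K J)
    (hi : ∀ v, Function.Injective (i.f v)) (p : RHom J B)
    (hp : ∀ v, Function.Surjective (p.f v))
    (hex : ∀ v x, p.f v x = 0 → ∃ y, i.f v y = x)
    (h1 : ExtZero P K) (h2 : ExtZero P B) : ExtZero P J := by
  intro g
  choose r hr using fun v => LinearMap.exists_rightInverse_of_surjective (p.f v)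
    (LinearMap.range_eq_top.2 (hp v))
  choose s hs using fun v => LinearMap.exists_leftInverse_of_injective (i.f v)
    (LinearMap.ker_eq_bot.2 (hi v))
  have hs' : ∀ v x, p.f v x = 0 → i.f v (s v x) = x := by
    intro v x hx
    obtain ⟨y, rfl⟩ := hex v x hx
    congr 1
    exact LinearMap.congr_fun (hs v) y
  obtain ⟨ψ, hψ⟩ := h2 (fun a => (p.f (Q.t a)).comp (g a))
  obtain ⟨χ, hχ⟩ := h1 (fun a => (s (Q.t a)).comp
    (g a - extMap P J (fun v => (r v).comp (ψ v)) a))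
  refine ⟨fun v => (r v).comp (ψ v) + (i.f v).comp (χ v), ?_⟩
  funext a
  ext x
  have e1 : extMap P B ψ a x = p.f _ (g a x) := by rw [hψ]; rfl
  have e2 : extMap P K χ a x = s _ (g a x - extMap P J (fun v => (r v).comp (ψ v)) a x) := by
    rw [hχ]; rfl
  have e3 : ∀ v y, p.f v (r v y) = y := fun v y => LinearMap.congr_fun (hr v) y
  have e4 : p.f _ (g a x - extMap P J (fun v => (r v).comp (ψ v)) a x) = 0 := by
    rw [map_sub, ← e1, extMap_apply', extMap_apply', map_sub, p.comm]
    simp [e3]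
  have e5 := hs' _ _ e4
  rw [← e2, extMap_apply', extMap_apply', map_sub, i.comm] at e5
  rw [extMap_apply']
  simp only [LinearMap.add_apply, LinearMap.comp_apply, map_add] at e5 ⊢
  rw [← sub_eq_zero]
  rw [← sub_eq_zero] at e5
  rw [← e5]
  abel

theorem extZero_mid_left {P K B I : Repn k Q} (i : RHom K P)
    (hi : ∀ v, Function.Injective (i.f v)) (p : RHom P B)
    (hp : ∀ v, Function.Surjective (p.f v))
    (hex : ∀ v x, p.f v x = 0 → ∃ y, i.f v y = x)
    (h1 : ExtZero K I) (h2 : ExtZero B I) : ExtZero P I := by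
  intro g
  choose r hr using fun v => LinearMap.exists_rightInverse_of_surjective (p.f v)
    (LinearMap.range_eq_top.2 (hp v))
  choose s hs using fun v => LinearMap.exists_leftInverse_of_injective (i.f v)
    (LinearMap.ker_eq_bot.2 (hi v))
  obtain ⟨ψ, hψ⟩ := h1 (fun a => (g a).comp (i.f (Q.s a)))
  obtain ⟨χ, hχ⟩ := h2 (fun a =>
    (g a - extMap P I (fun v => (ψ v).comp (s v)) a).comp (r (Q.s a)))
  refine ⟨fun v => (ψ v).comp (s v) + (χ v).comp (p.f v), ?_⟩
  funext a
  have e3 : ∀ v y, p.f v (r v y) = y := fun v y => LinearMap.congr_fun (hr v) y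
  have e4 : ∀ v y, s v (i.f v y) = y := fun v y => LinearMap.congr_fun (hs v) y
  have e0 : ∀ y, (g a - extMap P I (fun v => (ψ v).comp (s v)) a) (i.f _ y) = 0 := by
    intro y
    have e1 : extMap K I ψ a y = g a (i.f _ y) := by rw [hψ]; rfl
    rw [LinearMap.sub_apply, ← e1, extMap_apply', extMap_apply', ← i.comm]
    simp [e4]
  ext x
  have e6 : (g a - extMap P I (fun v => (ψ v).comp (s v)) a) (r _ (p.f _ x))
      = (g a - extMap P I (fun v => (ψ v).comp (s v)) a) x := by
    obtain ⟨y, hy⟩ := hex _ (x - r _ (p.f _ x)) (by rw [map_sub, e3, sub_self])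
    have := e0 y
    rw [hy, map_sub, sub_eq_zero] at this
    exact this.symm
  have e2 : extMap B I χ a (p.f _ x)
      = (g a - extMap P I (fun v => (ψ v).comp (s v)) a) (r _ (p.f _ x)) := by
    rw [hχ]; rfl
  rw [e6, LinearMap.sub_apply, extMap_apply', extMap_apply', ← p.comm] at e2
  rw [extMap_apply']
  simp only [LinearMap.add_apply, LinearMap.comp_apply, map_add] at e2 ⊢
  rw [← sub_eq_zero]
  rw [← sub_eq_zero] at e2
  rw [← e2]
  abel

/-- The inclusion of a subrepresentation. -/
def incl {M : Repn k Q} (U : Subrep M) : RHom U.repn M where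
  f v := (U.sub v).subtype
  comm _ _ := rfl

/-- The projection onto the quotient. -/
def proj {M : Repn k Q} (U : Subrep M) : RHom M U.quot where
  f v := (U.sub v).mkQ
  comm _ _ := rfl

theorem incl_inj {M : Repn k Q} (U : Subrep M) (v : Q.V) :
    Function.Injective ((incl U).f v) := Subtype.val_injective

theorem proj_surj {M : Repn k Q} (U : Subrep M) (v : Q.V) :
    Function.Surjective ((proj U).f v) := Submodule.mkQ_surjective _

theorem proj_zero {M : Repn k Q} (U : Subrep M) (v : Q.V) (x : M.space v) :
    (proj U).f v x = 0 ↔ x ∈ U.sub v := Submodule.Quotient.mk_eq_zero _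

/-- An extension splits if `Ext¹` vanishes. -/
theorem split_of_extZero {M : Repn k Q} (U : Subrep M) (h : ExtZero U.quot U.repn) :
    Nonempty (Repn.Iso M (U.repn.dsum U.quot)) := by
  choose r hr using fun v => LinearMap.exists_rightInverse_of_surjective ((proj U).f v)
    (LinearMap.range_eq_top.2 (proj_surj U v))
  have hr' : ∀ v y, (proj U).f v (r v y) = y := fun v y => LinearMap.congr_fun (hr v) y
  have hmem : ∀ a x, extMap U.quot M r a x ∈ U.sub (Q.t a) := by
    intro a x
    rw [← proj_zero, extMap_apply', map_sub, (proj U).comm, hr', hr', sub_self]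
  obtain ⟨χ, hχ⟩ := h (fun a => (extMap U.quot M r a).codRestrict (U.sub (Q.t a)) (hmem a))
  have hχ' : ∀ a x, (incl U).f _ (extMap U.quot U.repn χ a x) = extMap U.quot M r a x := by
    intro a x
    rw [hχ]; rfl
  let s : RHom U.quot M := ⟨fun v => r v - ((incl U).f v).comp (χ v), by
    intro a x
    have e := hχ' a x
    rw [extMap_apply', extMap_apply', map_sub, (incl U).comm, ← sub_eq_zero] at e
    simp only [LinearMap.sub_apply, LinearMap.comp_apply, map_sub]
    rw [← sub_eq_zero, ← e]
    abel⟩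
  have hs : ∀ v y, (proj U).f v (s.f v y) = y := by
    intro v y
    have : (proj U).f v ((incl U).f v (χ v y)) = 0 := (proj_zero U v _).2 (χ v y).2
    change (proj U).f v (r v y - (incl U).f v (χ v y)) = y
    rw [map_sub, hr', this, sub_zero]
  have hm : ∀ v x, x - s.f v ((proj U).f v x) ∈ U.sub v := by
    intro v x
    rw [← proj_zero, map_sub, hs, sub_self]
  let e : ∀ v, (U.repn.dsum U.quot).space v ≃ₗ[k] M.space v := fun v =>
    LinearEquiv.ofBijective (LinearMap.coprod ((incl U).f v) (s.f v)) (by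
      constructor
      · rw [← LinearMap.ker_eq_bot, LinearMap.ker_eq_bot']
        rintro ⟨u, y⟩ huy
        rw [LinearMap.coprod_apply] at huy
        have h1 : (proj U).f v ((incl U).f v u) = 0 := (proj_zero U v _).2 u.2
        have h2 : y = 0 := by
          have := congrArg ((proj U).f v) huy
          rwa [map_add, h1, hs, zero_add, map_zero] at this
        subst h2
        rw [map_zero, add_zero] at huy
        have : u = 0 := incl_inj U v (by rw [huy, map_zero])
        rw [this]; rfl
      · intro x
        refine ⟨(⟨x - s.f v ((proj U).f v x), hm v x⟩, (proj U).f v x), ?_⟩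
        rw [LinearMap.coprod_apply]
        exact sub_add_cancel _ _)
  have he : ∀ (a : Q.A) (x : (U.repn.dsum U.quot).space (Q.s a)),
      e (Q.t a) ((U.repn.dsum U.quot).map a x) = M.map a (e (Q.s a) x) := by
    rintro a ⟨u, y⟩
    change (incl U).f _ (U.repn.map a u) + s.f _ (U.quot.map a y)
      = M.map a ((incl U).f _ u + s.f _ y)
    rw [map_add, (incl U).comm, s.comm]
  refine ⟨⟨fun v => (e v).symm, fun a x => ?_⟩⟩
  rw [LinearEquiv.symm_apply_eq, he, LinearEquiv.apply_symm_apply]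

theorem isZero_repn {M : Repn k Q} (U : Subrep M) : U.repn.IsZero ↔ ∀ v, U.sub v = ⊥ := by
  constructor
  · intro h v
    rw [Submodule.eq_bot_iff]
    intro x hx
    exact congrArg Subtype.val (h v ⟨x, hx⟩)
  · intro h v x
    exact Subtype.ext ((Submodule.eq_bot_iff _).1 (h v) x.1 x.2)

theorem isZero_quot {M : Repn k Q} (U : Subrep M) : U.quot.IsZero ↔ ∀ v, U.sub v = ⊤ := by
  constructor
  · intro h v
    rw [Submodule.eq_top_iff']
    intro x
    exact (proj_zero U v x).1 (h v _)
  · intro h v x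
    obtain ⟨x, rfl⟩ := proj_surj U v x
    rw [proj_zero, h v]
    trivial

theorem indec_split {M : Repn k Q} (hM : M.Indec) (U : Subrep M) (h : ExtZero U.quot U.repn) :
    (∀ v, U.sub v = ⊥) ∨ (∀ v, U.sub v = ⊤) := by
  rw [← isZero_repn, ← isZero_quot]
  exact hM.2 _ _ (split_of_extZero U h)


/-- kernel -/
def kerS {M N : Repn k Q} (g : RHom M N) : Subrep M where
  sub v := LinearMap.ker (g.f v)
  stable a := by
    rintro _ ⟨x, hx, rfl⟩
    have hx' : g.f _ x = 0 := hx
    change g.f _ (M.map a x) = 0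
    rw [g.comm, hx', map_zero]

/-- image -/
def rangeS {M N : Repn k Q} (g : RHom M N) : Subrep N where
  sub v := LinearMap.range (g.f v)
  stable a := by
    rintro _ ⟨_, ⟨x, rfl⟩, rfl⟩
    exact ⟨M.map a x, g.comm a x⟩

/-- image of a subrepresentation -/
def mapS {M N : Repn k Q} (g : RHom M N) (U : Subrep M) : Subrep N where
  sub v := (U.sub v).map (g.f v)
  stable a := by
    rintro _ ⟨_, ⟨x, hx, rfl⟩, rfl⟩
    exact ⟨M.map a x, U.stable a ⟨x, hx, rfl⟩, g.comm a x⟩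

/-- preimage of a subrepresentation -/
def comapS {M N : Repn k Q} (g : RHom M N) (U : Subrep N) : Subrep M where
  sub v := (U.sub v).comap (g.f v)
  stable a := by
    rintro _ ⟨x, hx, rfl⟩
    change g.f _ (M.map a x) ∈ U.sub _
    rw [g.comm]
    exact U.stable a ⟨_, hx, rfl⟩

/-- corestriction to the image -/
def toRange {M N : Repn k Q} (g : RHom M N) : RHom M (rangeS g).repn where
  f v := (g.f v).rangeRestrict
  comm a x := Subtype.ext (g.comm a x)

theorem toRange_surj {M N : Repn k Q} (g : RHom M N) (v : Q.V) :
    Function.Surjective ((toRange g).f v) := LinearMap.surjective_rangeRestrict _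

/-- zero subrepresentation -/
def botS (M : Repn k Q) : Subrep M where
  sub v := ⊥
  stable a := by simp

/-- full subrepresentation -/
def topS (M : Repn k Q) : Subrep M where
  sub v := ⊤
  stable a := by simp

theorem Subrep_ext {M : Repn k Q} {U W : Subrep M} (h : ∀ v, U.sub v = W.sub v) : U = W := by
  cases U; cases W
  congr
  funext v
  exact h v

theorem vec_quot {M : Repn k Q} [FD M] (U : Subrep M) :
    natc U.repn.dimv + natc U.quot.dimv = natc M.dimv := by
  funext v
  have := Submodule.finrank_quotient_add_finrank (U.sub v)
  change ((Module.finrank k (U.sub v) : ℕ) : ℤ) + ((Module.finrank k (M.space v ⧸ U.sub v) : ℕ) : ℤ)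
    = ((Module.finrank k (M.space v) : ℕ) : ℤ)
  rw [← this]; push_cast; ring

theorem vec_ker {M N : Repn k Q} [FD M] (g : RHom M N) :
    natc (kerS g).repn.dimv + natc (rangeS g).repn.dimv = natc M.dimv := by
  funext v
  have := LinearMap.finrank_range_add_finrank_ker (g.f v)
  change ((Module.finrank k (LinearMap.ker (g.f v)) : ℕ) : ℤ)
    + ((Module.finrank k (LinearMap.range (g.f v)) : ℕ) : ℤ)
    = ((Module.finrank k (M.space v) : ℕ) : ℤ)
  rw [← this]; push_cast; ring

theorem vec_map {M N : Repn k Q} (g : RHom M N) (hg : ∀ v, Function.Injective (g.f v))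
    (U : Subrep M) : natc (mapS g U).repn.dimv = natc U.repn.dimv := by
  funext v
  change ((Module.finrank k ((U.sub v).map (g.f v)) : ℕ) : ℤ) = ((Module.finrank k (U.sub v) : ℕ) : ℤ)
  rw [← LinearEquiv.finrank_eq (Submodule.equivMapOfInjective (g.f v) (hg v) (U.sub v))]

theorem vec_comap {M : Repn k Q} [FD M] (U : Subrep M) (W : Subrep U.quot) :
    natc (comapS (proj U) W).repn.dimv = natc U.repn.dimv + natc W.repn.dimv := by
  funext v
  have h1 := LinearMap.finrank_range_add_finrank_ker ((W.sub v).mkQ.comp ((proj U).f v))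
  have hs : LinearMap.range ((W.sub v).mkQ.comp ((proj U).f v)) = ⊤ := by
    rw [LinearMap.range_eq_top, LinearMap.coe_comp]
    exact (Submodule.mkQ_surjective _).comp (proj_surj U v)
  rw [hs, LinearMap.ker_comp, Submodule.ker_mkQ, finrank_top] at h1
  have h2 := Submodule.finrank_quotient_add_finrank (W.sub v)
  have h3 := congrFun (vec_quot U) v
  have h4 : natc U.quot.dimv v = ((Module.finrank k (U.quot.space v) : ℕ) : ℤ) := rfl
  have h5 : natc M.dimv v = ((Module.finrank k (M.space v) : ℕ) : ℤ) := rfl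
  rw [Pi.add_apply, h4, h5, ← h2, ← h1] at h3
  rw [Pi.add_apply]
  change ((Module.finrank k ((W.sub v).comap ((proj U).f v)) : ℕ) : ℤ)
    = _ + ((Module.finrank k (W.sub v) : ℕ) : ℤ)
  push_cast at h3
  linarith

theorem vec_bot (M : Repn k Q) : natc (botS M).repn.dimv = 0 := by
  funext v
  change ((Module.finrank k (⊥ : Submodule k (M.space v)) : ℕ) : ℤ) = 0
  simp

theorem vec_top (M : Repn k Q) : natc (topS M).repn.dimv = natc M.dimv := by
  funext v
  change ((Module.finrank k (⊤ : Submodule k (M.space v)) : ℕ) : ℤ) = (Module.finrank k (M.space v) : ℕ)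
  simp

theorem vec_iso {M N : Repn k Q} (e : Repn.Iso M N) : M.dimv = N.dimv := by
  funext v
  exact LinearEquiv.finrank_eq (e.e v)

/-! ### The Euler form -/

theorem eulerZ_add_left (x y z : Q.V → ℤ) :
    eulerZ Q (x + y) z = eulerZ Q x z + eulerZ Q y z := by
  unfold eulerZ
  simp only [Pi.add_apply, add_mul, Finset.sum_add_distrib]
  ring

theorem eulerZ_add_right (x y z : Q.V → ℤ) :
    eulerZ Q x (y + z) = eulerZ Q x y + eulerZ Q x z := by
  unfold eulerZ
  simp only [Pi.add_apply, mul_add, Finset.sum_add_distrib]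
  ring

theorem eulerZ_smul_left (n : ℤ) (x y : Q.V → ℤ) :
    eulerZ Q (n • x) y = n * eulerZ Q x y := by
  unfold eulerZ
  simp only [Pi.smul_apply, smul_eq_mul, mul_assoc, ← Finset.mul_sum]
  ring

theorem eulerZ_smul_right (n : ℤ) (x y : Q.V → ℤ) :
    eulerZ Q x (n • y) = n * eulerZ Q x y := by
  unfold eulerZ
  simp only [Pi.smul_apply, smul_eq_mul, mul_left_comm _ n, ← Finset.mul_sum]
  ring

variable {δ : Q.V → ℕ}

theorem defect_add (x y : Q.V → ℤ) : defectOf Q δ (x + y) = defectOf Q δ x + defectOf Q δ y :=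
  eulerZ_add_right _ _ _

theorem defect_zero : defectOf Q δ 0 = 0 := by
  simp [defectOf, eulerZ]

/-- Standing assumptions. -/
structure Aff (Q : QuiverData) (δ : Q.V → ℕ) : Prop where
  psd : ∀ d : Q.V → ℤ, 0 ≤ titsZ Q d
  min : IsMinImagRoot Q δ

theorem Aff.anti (h : Aff Q δ) (x : Q.V → ℤ) :
    eulerZ Q x (natc δ) = - defectOf Q δ x := by
  have key : ∀ n : ℤ, 0 ≤ titsZ Q x + n * (eulerZ Q x (natc δ) + defectOf Q δ x) := by
    intro n
    have h1 := h.psd (x + n • natc δ)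
    have h2 := h.min.2.1
    unfold titsZ at *
    rw [eulerZ_add_left, eulerZ_add_right, eulerZ_add_right, eulerZ_smul_left, eulerZ_smul_right,
      eulerZ_smul_left, eulerZ_smul_right, h2] at h1
    unfold defectOf
    linarith
  have h0 := h.psd x
  set c := eulerZ Q x (natc δ) + defectOf Q δ x with hc
  have h1 := key (-(titsZ Q x + 1) * c)
  have h2 : c = 0 := by
    by_contra hne
    have : 1 ≤ c * c := by
      have := mul_self_pos.2 hne
      linarith
    nlinarith
  linarith

theorem Aff.isotropic (h : Aff Q δ) : ∀ (N : ℕ) (d : Q.V → ℕ), ∑ v, d v ≤ N →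
    titsZ Q (natc d) = 0 → ∃ n : ℕ, natc d = (n : ℤ) • natc δ := by
  intro N
  induction N with
  | zero =>
    intro d hd _
    refine ⟨0, ?_⟩
    funext v
    have : d v ≤ ∑ v, d v := Finset.single_le_sum (f := d) (fun _ _ => Nat.zero_le _) (Finset.mem_univ v)
    simp [natc]; omega
  | succ N ih =>
    intro d hd hq
    by_cases h0 : d = 0
    · refine ⟨0, ?_⟩
      subst h0
      funext v
      simp [natc]
    have hle := h.min.2.2 d h0 hq
    have hadd : natc d = natc (fun v => d v - δ v) + natc δ := by
      funext v
      simp only [natc, Pi.add_apply]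
      have := hle v
      omega
    obtain ⟨n, hn⟩ := ih (fun v => d v - δ v) (by
      have hlt : ∑ v, (d v - δ v) < ∑ v, d v := by
        obtain ⟨w, hw⟩ := Function.ne_iff.1 h.min.1
        refine Finset.sum_lt_sum (fun v _ => Nat.sub_le _ _) ⟨w, Finset.mem_univ _, ?_⟩
        have := hle w
        simp only [Pi.zero_apply] at hw
        omega
      omega) (by
      have h1 := h.anti (natc (fun v => d v - δ v))
      have h2 := h.min.2.1
      unfold titsZ at *
      rw [hadd, eulerZ_add_left, eulerZ_add_right, eulerZ_add_right, h2, h1] at hq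
      unfold defectOf at hq
      linarith)
    refine ⟨n + 1, ?_⟩
    rw [hadd, hn]
    push_cast
    rw [add_smul, one_smul]

theorem Aff.pos_or (h : Aff Q δ) (d : Q.V → ℕ) :
    0 < titsZ Q (natc d) ∨ ∃ n : ℕ, natc d = (n : ℤ) • natc δ := by
  rcases (h.psd (natc d)).lt_or_eq with h1 | h1
  · exact Or.inl h1
  · exact Or.inr (h.isotropic _ d le_rfl h1.symm)

theorem Aff.defect_smul (h : Aff Q δ) (n : ℤ) : defectOf Q δ (n • natc δ) = 0 := by
  unfold defectOf
  rw [eulerZ_smul_right]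
  have := h.min.2.1
  unfold titsZ at this
  rw [this, mul_zero]

theorem Aff.pos (h : Aff Q δ) (d : Q.V → ℕ) (hd : defectOf Q δ (natc d) ≠ 0) :
    0 < titsZ Q (natc d) := by
  rcases h.pos_or d with h1 | ⟨n, hn⟩
  · exact h1
  · rw [hn, h.defect_smul] at hd
    exact absurd rfl hd

/-! ### Classes of modules defined by the defect -/

/-- The defect of a representation. -/
noncomputable def D (δ : Q.V → ℕ) (M : Repn k Q) : ℤ := defectOf Q δ (natc M.dimv)

/-- all nonzero submodules have negative defect -/
def InP (δ : Q.V → ℕ) (M : Repn k Q) : Prop :=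
  ∀ U : Subrep M, (∃ v, U.sub v ≠ ⊥) → D δ U.repn < 0

/-- all quotients have nonnegative defect -/
def InJ (δ : Q.V → ℕ) (M : Repn k Q) : Prop := ∀ U : Subrep M, D δ U.repn ≤ D δ M

/-- all nonzero quotients have positive defect -/
def InI (δ : Q.V → ℕ) (M : Repn k Q) : Prop :=
  ∀ U : Subrep M, (∃ v, U.sub v ≠ ⊤) → D δ U.repn < D δ M

/-- all submodules have nonpositive defect -/
def InR (δ : Q.V → ℕ) (M : Repn k Q) : Prop := ∀ U : Subrep M, D δ U.repn ≤ 0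

theorem D_quot {M : Repn k Q} [FD M] (U : Subrep M) : D δ U.repn + D δ U.quot = D δ M := by
  unfold D
  rw [← defect_add, vec_quot]

theorem D_ker {M N : Repn k Q} [FD M] (g : RHom M N) :
    D δ (kerS g).repn + D δ (rangeS g).repn = D δ M := by
  unfold D
  rw [← defect_add, vec_ker]

theorem D_map {M N : Repn k Q} (g : RHom M N) (hg : ∀ v, Function.Injective (g.f v))
    (U : Subrep M) : D δ (mapS g U).repn = D δ U.repn := by
  unfold D
  rw [vec_map g hg]

theorem D_comap {M : Repn k Q} [FD M] (U : Subrep M) (W : Subrep U.quot) :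
    D δ (comapS (proj U) W).repn = D δ U.repn + D δ W.repn := by
  unfold D
  rw [← defect_add, vec_comap]

theorem D_bot (M : Repn k Q) : D δ (botS M).repn = 0 := by
  unfold D
  rw [vec_bot, defect_zero]

theorem D_top (M : Repn k Q) : D δ (topS M).repn = D δ M := by
  unfold D
  rw [vec_top]

theorem InP.of_inj {A M : Repn k Q} (i : RHom A M) (hi : ∀ v, Function.Injective (i.f v))
    (h : InP δ M) : InP δ A := by
  rintro U ⟨v, hv⟩
  rw [← D_map i hi]
  refine h _ ⟨v, fun h0 => hv ?_⟩
  exact Submodule.map_injective_of_injective (hi v) (h0.trans (Submodule.map_bot _).symm)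

theorem InR.of_inj {A M : Repn k Q} (i : RHom A M) (hi : ∀ v, Function.Injective (i.f v))
    (h : InR δ M) : InR δ A := by
  intro U
  rw [← D_map i hi]
  exact h _

theorem InJ.quot {M : Repn k Q} [FD M] (h : InJ δ M) (U : Subrep M) : InJ δ U.quot := by
  intro W
  have h1 := h (comapS (proj U) W)
  rw [D_comap, ← D_quot U] at h1
  linarith


/-! ### Counting -/

theorem averaging {Γ S : Type} [Finite Γ] [Nonempty Γ] [Finite S] (H : Γ → Type)
    [∀ g, Finite (H g)] (κ : (Σ g, H g) → S) (q : ℕ) (hq : 2 ≤ q) (E : S → ℤ) (b : S) (E0 : ℤ)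
    (hb : E b = E0) (hE : ∀ s, s ≠ b → E s ≤ E0 - Nat.card S)
    (hT : ∀ s, (Nat.card {x // κ x = s} : ℚ) ≤ Nat.card Γ * (q : ℚ) ^ (E s)) :
    ∃ g, (Nat.card (H g) : ℚ) < (q : ℚ) ^ (E0 + 1) := by
  classical
  have := Fintype.ofFinite Γ
  have := Fintype.ofFinite S
  by_contra! hcon
  have hq0 : (0 : ℚ) < q := by exact_mod_cast (by omega : 0 < q)
  have hq1 : (1 : ℚ) ≤ q := by exact_mod_cast (by omega : 1 ≤ q)
  have hΓ : (0 : ℚ) < Nat.card Γ := by exact_mod_cast Nat.card_pos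
  have h1 : (Nat.card (Σ g, H g) : ℚ) = ∑ g, (Nat.card (H g) : ℚ) := by
    rw [Nat.card_sigma]; push_cast; rfl
  have h2 : (Nat.card (Σ g, H g) : ℚ) = ∑ s, (Nat.card {x // κ x = s} : ℚ) := by
    rw [← Nat.card_congr (Equiv.sigmaFiberEquiv κ), Nat.card_sigma]; push_cast; rfl
  have h3 : (Nat.card Γ : ℚ) * (q : ℚ) ^ (E0 + 1) ≤ ∑ g, (Nat.card (H g) : ℚ) := by
    have := Finset.sum_le_sum (s := Finset.univ) (fun g _ => hcon g)
    rwa [Finset.sum_const, Finset.card_univ, nsmul_eq_mul, ← Nat.card_eq_fintype_card] at this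
  have h4 : ∑ s, (Nat.card {x // κ x = s} : ℚ) ≤ (Nat.card Γ : ℚ) * ∑ s, (q : ℚ) ^ (E s) := by
    rw [Finset.mul_sum]
    exact Finset.sum_le_sum fun s _ => hT s
  have h5 : ∑ s, (q : ℚ) ^ (E s)
      ≤ (q : ℚ) ^ E0 + Nat.card S * (q : ℚ) ^ (E0 - Nat.card S) := by
    rw [← Finset.add_sum_erase _ _ (Finset.mem_univ b), hb]
    gcongr
    calc ∑ s ∈ Finset.univ.erase b, (q : ℚ) ^ (E s)
        ≤ ∑ s ∈ Finset.univ.erase b, (q : ℚ) ^ (E0 - Nat.card S) := by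
          refine Finset.sum_le_sum fun s hs => ?_
          exact zpow_le_zpow_right₀ hq1 (hE s (Finset.ne_of_mem_erase hs))
      _ ≤ ∑ s : S, (q : ℚ) ^ (E0 - Nat.card S) := by
          refine Finset.sum_le_sum_of_subset_of_nonneg (Finset.erase_subset _ _) ?_
          intros; positivity
      _ = _ := by
          rw [Finset.sum_const, Finset.card_univ, nsmul_eq_mul, ← Nat.card_eq_fintype_card]
  have h6 : (Nat.card S : ℚ) * (q : ℚ) ^ (E0 - Nat.card S) < (q : ℚ) ^ E0 := by
    rw [zpow_sub₀ hq0.ne', mul_div_assoc', div_lt_iff₀ (by positivity), mul_comm]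
    gcongr
    rw [zpow_natCast]
    have : Nat.card S < q ^ Nat.card S :=
      lt_of_lt_of_le Nat.lt_two_pow_self (Nat.pow_le_pow_left hq _)
    exact_mod_cast this
  have h7 : (q : ℚ) ^ (E0 + 1) < (q : ℚ) ^ E0 + (q : ℚ) ^ E0 := by
    have : (q : ℚ) ^ (E0 + 1) ≤ ∑ s, (q : ℚ) ^ (E s) := by
      have := h3.trans (h1.symm.trans h2).le |>.trans h4
      exact le_of_mul_le_mul_left this hΓ
    linarith
  rw [zpow_add₀ hq0.ne', zpow_one] at h7
  have h8 : (2 : ℚ) ≤ q := by exact_mod_cast hq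
  have h9 : (0 : ℚ) < (q : ℚ) ^ E0 := by positivity
  nlinarith

theorem space_finite [Finite k] (M : Repn k Q) [FD M] (v : Q.V) : Finite (M.space v) :=
  Module.finite_of_finite k

instance [Finite k] (M : Repn k Q) [FD M] : Finite (Subrep M) := by
  have := fun v => space_finite M v
  exact Finite.of_injective (fun U : Subrep M => U.sub)
    (fun U W h => Subrep_ext fun v => congrFun h v)

instance [Finite k] (M N : Repn k Q) [FD M] [FD N] : Finite (RHom M N) := by
  have := Module.finite_of_finite k (M := ∀ v, M.space v →ₗ[k] N.space v)
  exact Finite.of_injective (fun g : RHom M N => g.f)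
    (fun U W h => RHom.ext' fun v x => by rw [show U.f = W.f from h])

theorem card_rhom [Finite k] (M N : Repn k Q) [FD M] [FD N] :
    Nat.card (RHom M N) = Nat.card k ^ homDim M N := by
  rw [Nat.card_congr (homEquiv M N), Module.natCard_eq_pow_finrank (K := k)]
  rfl

/-- Points of the representation space. -/
abbrev G (k : Type) [Field k] {Q : QuiverData} (y : Q.V → ℕ) : Type :=
  ∀ a : Q.A, (Fin (y (Q.s a)) → k) →ₗ[k] (Fin (y (Q.t a)) → k)

/-- The representation given by a point of the representation space. -/
def rnd (y : Q.V → ℕ) (g : G k y) : Repn k Q where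
  space v := Fin (y v) → k
  map a := g a

instance (y : Q.V → ℕ) (g : G k y) : FD (rnd y g) :=
  ⟨fun v => inferInstanceAs (FiniteDimensional k (Fin (y v) → k))⟩

theorem dimv_rnd (y : Q.V → ℕ) (g : G k y) : (rnd y g).dimv = y := by
  funext v
  change Module.finrank k (Fin (y v) → k) = y v
  simp

theorem count_left [Finite k] (P : Repn k Q) [FD P] (y : Q.V → ℕ) (K : Subrep P) :
    Nat.card {x : Σ g : G k y, RHom P (rnd y g) // kerS x.2 = K}
      * Nat.card (∀ a, (P.space (Q.s a) ⧸ K.sub (Q.s a)) →ₗ[k] (Fin (y (Q.t a)) → k))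
    ≤ Nat.card (∀ v, (P.space v ⧸ K.sub v) →ₗ[k] (Fin (y v) → k)) * Nat.card (G k y) := by
  have hρ : ∀ v (φ : (P.space v ⧸ K.sub v) →ₗ[k] (Fin (y v) → k)),
      ∃ r : (Fin (y v) → k) →ₗ[k] (P.space v ⧸ K.sub v),
        Function.Injective φ → r.comp φ = LinearMap.id := by
    intro v φ
    by_cases h : Function.Injective φ
    · obtain ⟨r, hr⟩ := LinearMap.exists_leftInverse_of_injective φ (LinearMap.ker_eq_bot.2 h)
      exact ⟨r, fun _ => hr⟩
    · exact ⟨0, fun h' => absurd h' h⟩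
  choose ρ hρ using hρ
  have hker : ∀ (x : {x : Σ g : G k y, RHom P (rnd y g) // kerS x.2 = K}) (v : Q.V),
      K.sub v = LinearMap.ker (x.1.2.f v) := fun x v =>
    congrArg (fun W : Subrep P => W.sub v) x.2.symm
  let fb : ∀ (x : {x : Σ g : G k y, RHom P (rnd y g) // kerS x.2 = K}) (v : Q.V),
      (P.space v ⧸ K.sub v) →ₗ[k] (Fin (y v) → k) :=
    fun x v => (K.sub v).liftQ (x.1.2.f v) (hker x v).le
  have hfb : ∀ x v, Function.Injective (fb x v) := by
    intro x v
    rw [← LinearMap.ker_eq_bot]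
    exact Submodule.ker_liftQ_eq_bot _ _ _ (hker x v).ge
  have hfb' : ∀ x v p, fb x v ((K.sub v).mkQ p) = x.1.2.f v p := fun x v p => rfl
  rw [← Nat.card_prod, ← Nat.card_prod]
  have := Module.finite_of_finite k (M := ∀ v, (P.space v ⧸ K.sub v) →ₗ[k] (Fin (y v) → k))
  have := Module.finite_of_finite k (M := G k y)
  refine Nat.card_le_card_of_injective
    (fun z => (fb z.1, fun a => z.1.1.1 a + (z.2 a).comp (ρ _ (fb z.1 (Q.s a))))) ?_
  rintro ⟨x, h⟩ ⟨x', h'⟩ heq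
  obtain ⟨e1, e2⟩ := Prod.mk.inj heq
  simp only at e1 e2
  have e3 : ∀ v p, x.1.2.f v p = x'.1.2.f v p := by
    intro v p
    rw [← hfb', ← hfb', e1]
  have ec : ∀ (z : {x : Σ g : G k y, RHom P (rnd y g) // kerS x.2 = K}) a p,
      z.1.1 a (z.1.2.f _ p) = z.1.2.f _ (P.map a p) := fun z a p => (z.1.2.comm a p).symm
  have e4 : h = h' := by
    funext a
    refine LinearMap.ext fun w => ?_
    obtain ⟨p, rfl⟩ := Submodule.mkQ_surjective _ w
    have e5 : x.1.1 a (x.1.2.f _ p) + h a (ρ _ (fb x (Q.s a)) (x.1.2.f _ p))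
        = x'.1.1 a (x.1.2.f _ p) + h' a (ρ _ (fb x' (Q.s a)) (x.1.2.f _ p)) :=
      LinearMap.congr_fun (congrFun e2 a) (x.1.2.f _ p)
    have e6 : ρ _ (fb x (Q.s a)) (x.1.2.f _ p) = (K.sub (Q.s a)).mkQ p :=
      LinearMap.congr_fun (hρ _ _ (hfb x (Q.s a))) ((K.sub (Q.s a)).mkQ p)
    have e7 : x'.1.1 a (x.1.2.f _ p) = x.1.1 a (x.1.2.f _ p) := by
      rw [ec, e3, e3, ec]
    rw [← e1, e6, e7] at e5
    exact add_left_cancel e5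
  subst e4
  have e5 : x.1.1 = x'.1.1 := by
    funext a
    have := congrFun e2 a
    simp only [e1] at this
    exact add_right_cancel this
  obtain ⟨⟨g, f⟩, hx⟩ := x
  obtain ⟨⟨g', f'⟩, hx'⟩ := x'
  simp only at e5
  subst e5
  have : f = f' := RHom.ext' e3
  subst this
  rfl

theorem count_right [Finite k] (I : Repn k Q) [FD I] (y : Q.V → ℕ) (L : Subrep I) :
    Nat.card {x : Σ g : G k y, RHom (rnd y g) I // rangeS x.2 = L}
      * Nat.card (∀ a, (Fin (y (Q.s a)) → k) →ₗ[k] L.sub (Q.t a))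
    ≤ Nat.card (∀ v, (Fin (y v) → k) →ₗ[k] L.sub v) * Nat.card (G k y) := by
  have hρ : ∀ v (φ : (Fin (y v) → k) →ₗ[k] L.sub v),
      ∃ r : L.sub v →ₗ[k] (Fin (y v) → k),
        Function.Surjective φ → φ.comp r = LinearMap.id := by
    intro v φ
    by_cases h : Function.Surjective φ
    · obtain ⟨r, hr⟩ := LinearMap.exists_rightInverse_of_surjective φ (LinearMap.range_eq_top.2 h)
      exact ⟨r, fun _ => hr⟩
    · exact ⟨0, fun h' => absurd h' h⟩
  choose ρ hρ using hρ
  have hran : ∀ (x : {x : Σ g : G k y, RHom (rnd y g) I // rangeS x.2 = L}) (v : Q.V),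
      LinearMap.range (x.1.2.f v) = L.sub v := fun x v =>
    congrArg (fun W : Subrep I => W.sub v) x.2
  let fb : ∀ (x : {x : Σ g : G k y, RHom (rnd y g) I // rangeS x.2 = L}) (v : Q.V),
      (Fin (y v) → k) →ₗ[k] L.sub v :=
    fun x v => (x.1.2.f v).codRestrict (L.sub v) (fun w => (hran x v).le ⟨w, rfl⟩)
  have hfb : ∀ x v, Function.Surjective (fb x v) := by
    rintro x v ⟨w, hw⟩
    obtain ⟨u, hu⟩ := (hran x v).ge hw
    exact ⟨u, Subtype.ext hu⟩
  have hfb' : ∀ x v p, (fb x v p : I.space v) = x.1.2.f v p := fun x v p => rfl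
  rw [← Nat.card_prod, ← Nat.card_prod]
  have := Module.finite_of_finite k (M := ∀ v, (Fin (y v) → k) →ₗ[k] L.sub v)
  have := Module.finite_of_finite k (M := G k y)
  refine Nat.card_le_card_of_injective
    (fun z => (fb z.1, fun a => z.1.1.1 a + (ρ _ (fb z.1 (Q.t a))).comp (z.2 a))) ?_
  rintro ⟨x, h⟩ ⟨x', h'⟩ heq
  obtain ⟨e1, e2⟩ := Prod.mk.inj heq
  simp only at e1 e2
  have e3 : ∀ v p, x.1.2.f v p = x'.1.2.f v p :=
    fun v p => congrArg (fun φ => ((φ v p : L.sub v) : I.space v)) e1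
  have ec : ∀ (z : {x : Σ g : G k y, RHom (rnd y g) I // rangeS x.2 = L}) a p,
      z.1.2.f _ (z.1.1 a p) = I.map a (z.1.2.f _ p) := fun z a p => z.1.2.comm a p
  have e4 : h = h' := by
    funext a
    refine LinearMap.ext fun p => ?_
    have e5 := congrArg (fb x (Q.t a)) (LinearMap.congr_fun (congrFun e2 a) p)
    have e6 : ∀ w, fb x (Q.t a) (ρ _ (fb x (Q.t a)) w) = w := fun w =>
      LinearMap.congr_fun (hρ _ _ (hfb x (Q.t a))) w
    have e7 : fb x (Q.t a) (x'.1.1 a p) = fb x (Q.t a) (x.1.1 a p) := by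
      apply Subtype.ext
      calc (fb x (Q.t a) (x'.1.1 a p) : I.space (Q.t a)) = fb x' (Q.t a) (x'.1.1 a p) := by rw [e1]
        _ = I.map a (fb x' (Q.s a) p) := ec x' a p
        _ = I.map a (fb x (Q.s a) p) := by rw [e1]
        _ = fb x (Q.t a) (x.1.1 a p) := (ec x a p).symm
    simp only [LinearMap.add_apply, LinearMap.comp_apply, map_add] at e5
    rw [← e1, e6, e6, e7] at e5
    exact add_left_cancel e5
  subst e4
  have e5 : x.1.1 = x'.1.1 := by
    funext a
    have := congrFun e2 a
    simp only [e1] at this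
    exact add_right_cancel this
  obtain ⟨⟨g, f⟩, hx⟩ := x
  obtain ⟨⟨g', f'⟩, hx'⟩ := x'
  simp only at e5
  subst e5
  have : f = f' := RHom.ext' e3
  subst this
  rfl

theorem zpow_aux (q T G' a b : ℕ) (hq : 0 < q) (h : T * q ^ a ≤ q ^ b * G') :
    (T : ℚ) ≤ G' * (q : ℚ) ^ ((b : ℤ) - a) := by
  have hq0 : (0 : ℚ) < q := by exact_mod_cast hq
  rw [zpow_sub₀ hq0.ne', mul_div_assoc', le_div_iff₀ (by positivity), zpow_natCast, zpow_natCast,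
    mul_comm (G' : ℚ)]
  exact_mod_cast h

theorem count_left' [Finite k] (P : Repn k Q) [FD P] (y : Q.V → ℕ) (K : Subrep P) :
    (Nat.card {x : Σ g : G k y, RHom P (rnd y g) // kerS x.2 = K} : ℚ)
    ≤ Nat.card (G k y) * (Nat.card k : ℚ) ^ (eulerZ Q (natc K.quot.dimv) (natc y)) := by
  have h := count_left P y K
  rw [Module.natCard_eq_pow_finrank (K := k)
      (V := ∀ a, (P.space (Q.s a) ⧸ K.sub (Q.s a)) →ₗ[k] (Fin (y (Q.t a)) → k)),
    Module.natCard_eq_pow_finrank (K := k)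
      (V := ∀ v, (P.space v ⧸ K.sub v) →ₗ[k] (Fin (y v) → k))] at h
  convert zpow_aux _ _ _ _ _ Nat.card_pos h using 3
  rw [Module.finrank_pi_fintype, Module.finrank_pi_fintype]
  simp only [Module.finrank_linearMap, Module.finrank_fin_fun]
  unfold eulerZ natc
  push_cast
  rfl

theorem count_right' [Finite k] (I : Repn k Q) [FD I] (y : Q.V → ℕ) (L : Subrep I) :
    (Nat.card {x : Σ g : G k y, RHom (rnd y g) I // rangeS x.2 = L} : ℚ)
    ≤ Nat.card (G k y) * (Nat.card k : ℚ) ^ (eulerZ Q (natc y) (natc L.repn.dimv)) := by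
  have h := count_right I y L
  rw [Module.natCard_eq_pow_finrank (K := k)
      (V := ∀ a, (Fin (y (Q.s a)) → k) →ₗ[k] L.sub (Q.t a)),
    Module.natCard_eq_pow_finrank (K := k)
      (V := ∀ v, (Fin (y v) → k) →ₗ[k] L.sub v)] at h
  convert zpow_aux _ _ _ _ _ Nat.card_pos h using 3
  rw [Module.finrank_pi_fintype, Module.finrank_pi_fintype]
  simp only [Module.finrank_linearMap, Module.finrank_fin_fun]
  unfold eulerZ natc
  push_cast
  rfl

theorem two_le_card [Finite k] : 2 ≤ Nat.card k := Finite.one_lt_card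

theorem natc_y (y0 : Q.V → ℕ) (m : ℕ) :
    natc (fun v => y0 v + m * δ v) = natc y0 + (m : ℤ) • natc δ := by
  funext v
  simp [natc]

/-- Existence of modules with no extensions with a given one in the class `InP`. -/
theorem exists_left [Finite k] (hA : Aff Q δ) (P : Repn k Q) [FD P] (hP : InP δ P)
    (y0 : Q.V → ℕ) : ∃ (m : ℕ) (g : G k (fun v => y0 v + m * δ v)),
      ExtZero P (rnd (fun v => y0 v + m * δ v) g) := by
  have := Fintype.ofFinite (Subrep P)
  let B : ℕ := ∑ K : Subrep P, (eulerZ Q (natc K.repn.dimv) (natc y0)).natAbs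
  let m := Nat.card (Subrep P) + B
  let y : Q.V → ℕ := fun v => y0 v + m * δ v
  have hy : natc y = natc y0 + (m : ℤ) • natc δ := natc_y y0 m
  have hlow : ∀ K : Subrep P, K ≠ botS P →
      (Nat.card (Subrep P) : ℤ) ≤ eulerZ Q (natc K.repn.dimv) (natc y) := by
    intro K hK
    have h1 : D δ K.repn < 0 := by
      refine hP K ?_
      by_contra! h
      exact hK (Subrep_ext h)
    rw [hy, eulerZ_add_right, eulerZ_smul_right, hA.anti]
    have h2 : (eulerZ Q (natc K.repn.dimv) (natc y0)).natAbs ≤ B :=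
      Finset.single_le_sum (f := fun K : Subrep P => (eulerZ Q (natc K.repn.dimv) (natc y0)).natAbs)
        (fun _ _ => Nat.zero_le _) (Finset.mem_univ K)
    have h3 : (m : ℤ) = Nat.card (Subrep P) + B := by simp [m]
    have h4 : - (B : ℤ) ≤ eulerZ Q (natc K.repn.dimv) (natc y0) := by omega
    have h5 : (m : ℤ) ≤ m * -defectOf Q δ (natc K.repn.dimv) := by
      have : 1 ≤ -defectOf Q δ (natc K.repn.dimv) := by unfold D at h1; omega
      nlinarith
    linarith
  have hq : ∀ K : Subrep P, eulerZ Q (natc K.quot.dimv) (natc y)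
      = eulerZ Q (natc P.dimv) (natc y) - eulerZ Q (natc K.repn.dimv) (natc y) := by
    intro K
    rw [← vec_quot K, eulerZ_add_left]; ring
  have := Module.finite_of_finite k (M := G k y)
  obtain ⟨g, hg⟩ := averaging (Γ := G k y) (fun g => RHom P (rnd y g)) (fun x => kerS x.2)
    (Nat.card k) two_le_card (fun K => eulerZ Q (natc K.quot.dimv) (natc y)) (botS P)
    (eulerZ Q (natc P.dimv) (natc y))
    (by rw [hq, vec_bot]; simp [eulerZ])
    (by intro K hK; simp only [hq]; have := hlow K hK; linarith)
    (fun K => count_left' P y K)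
  refine ⟨m, g, ?_⟩
  change ExtZero P (rnd y g)
  rw [extZero_iff]
  rw [card_rhom] at hg
  have h1 := euler_form P (rnd y g)
  rw [dimv_rnd] at h1
  have h2 : (1 : ℚ) < Nat.card k := by exact_mod_cast two_le_card (k := k)
  push_cast at hg
  rw [← zpow_natCast, zpow_lt_zpow_iff_right₀ h2] at hg
  omega

theorem exists_right [Finite k] (hA : Aff Q δ) (I : Repn k Q) [FD I] (hI : InI δ I)
    (y0 : Q.V → ℕ) : ∃ (m : ℕ) (g : G k (fun v => y0 v + m * δ v)),
      ExtZero (rnd (fun v => y0 v + m * δ v) g) I := by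
  have := Fintype.ofFinite (Subrep I)
  let B : ℕ := ∑ K : Subrep I, (eulerZ Q (natc y0) (natc K.quot.dimv)).natAbs
  let m := Nat.card (Subrep I) + B
  let y : Q.V → ℕ := fun v => y0 v + m * δ v
  have hy : natc y = natc y0 + (m : ℤ) • natc δ := natc_y y0 m
  have hlow : ∀ K : Subrep I, K ≠ topS I →
      (Nat.card (Subrep I) : ℤ) ≤ eulerZ Q (natc y) (natc K.quot.dimv) := by
    intro K hK
    have h1 : 0 < D δ K.quot := by
      have := hI K (by
        by_contra! h
        exact hK (Subrep_ext h))
      have h2 := D_quot (δ := δ) K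
      omega
    rw [hy, eulerZ_add_left, eulerZ_smul_left]
    have h2 : (eulerZ Q (natc y0) (natc K.quot.dimv)).natAbs ≤ B :=
      Finset.single_le_sum (f := fun K : Subrep I => (eulerZ Q (natc y0) (natc K.quot.dimv)).natAbs)
        (fun _ _ => Nat.zero_le _) (Finset.mem_univ K)
    have h3 : (m : ℤ) = Nat.card (Subrep I) + B := by simp [m]
    have h4 : - (B : ℤ) ≤ eulerZ Q (natc y0) (natc K.quot.dimv) := by omega
    have h5 : (m : ℤ) ≤ m * eulerZ Q (natc δ) (natc K.quot.dimv) := by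
      have : 1 ≤ eulerZ Q (natc δ) (natc K.quot.dimv) := by unfold D defectOf at h1; omega
      nlinarith
    linarith
  have hq : ∀ K : Subrep I, eulerZ Q (natc y) (natc K.repn.dimv)
      = eulerZ Q (natc y) (natc I.dimv) - eulerZ Q (natc y) (natc K.quot.dimv) := by
    intro K
    rw [← vec_quot K, eulerZ_add_right]; ring
  have := Module.finite_of_finite k (M := G k y)
  obtain ⟨g, hg⟩ := averaging (Γ := G k y) (fun g => RHom (rnd y g) I) (fun x => rangeS x.2)
    (Nat.card k) two_le_card (fun K => eulerZ Q (natc y) (natc K.repn.dimv)) (topS I)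
    (eulerZ Q (natc y) (natc I.dimv))
    (by rw [vec_top])
    (by intro K hK; simp only [hq]; have := hlow K hK; linarith)
    (fun K => count_right' I y K)
  refine ⟨m, g, ?_⟩
  change ExtZero (rnd y g) I
  rw [extZero_iff]
  rw [card_rhom] at hg
  have h1 := euler_form (rnd y g) I
  rw [dimv_rnd] at h1
  have h2 : (1 : ℚ) < Nat.card k := by exact_mod_cast two_le_card (k := k)
  push_cast at hg
  rw [← zpow_natCast, zpow_lt_zpow_iff_right₀ h2] at hg
  omega


/-- total dimension -/
noncomputable def td (M : Repn k Q) : ℕ := ∑ v, M.dimv v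

theorem td_of_natc {M N L : Repn k Q} (h : natc M.dimv + natc N.dimv = natc L.dimv) :
    td M + td N = td L := by
  unfold td
  rw [← Finset.sum_add_distrib]
  refine Finset.sum_congr rfl fun v _ => ?_
  have := congrFun h v
  simp only [natc, Pi.add_apply] at this
  exact_mod_cast this

theorem td_quot {M : Repn k Q} [FD M] (U : Subrep M) : td U.repn + td U.quot = td M :=
  td_of_natc (vec_quot U)

theorem td_ker {M N : Repn k Q} [FD M] (g : RHom M N) :
    td (kerS g).repn + td (rangeS g).repn = td M :=
  td_of_natc (vec_ker g)

theorem td_zero {M : Repn k Q} [FD M] (h : td M = 0) : M.IsZero := by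
  intro v x
  have h1 : M.dimv v = 0 := (Finset.sum_eq_zero_iff.1 h) v (Finset.mem_univ v)
  have := Module.finrank_zero_iff.1 h1
  exact Subsingleton.elim _ _

theorem zero_dimv {M : Repn k Q} (h : M.IsZero) : natc M.dimv = 0 := by
  funext v
  have : Subsingleton (M.space v) := ⟨fun a b => (h v a).trans (h v b).symm⟩
  have h1 : Module.finrank k (M.space v) = 0 := Module.finrank_zero_of_subsingleton
  simp [natc, Repn.dimv, h1]

theorem td_pos {M : Repn k Q} [FD M] (h : ¬ M.IsZero) : 0 < td M :=
  Nat.pos_of_ne_zero fun h' => h (td_zero h')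

theorem not_isZero {M : Repn k Q} {v : Q.V} {x : M.space v} (h : x ≠ 0) : ¬ M.IsZero :=
  fun h' => h (h' v x)

theorem extZero_left_zero {P J : Repn k Q} (h : P.IsZero) : ExtZero P J := by
  intro g
  refine ⟨0, ?_⟩
  funext a
  refine LinearMap.ext fun x => ?_
  rw [h _ x, map_zero, map_zero]

theorem extZero_right_zero {P J : Repn k Q} (h : J.IsZero) : ExtZero P J := by
  intro g
  refine ⟨0, ?_⟩
  funext a
  refine LinearMap.ext fun x => ?_
  rw [h _ (g a x)]
  exact h _ _

theorem exists_hom (M N : Repn k Q) [FD M] [FD N]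
    (h : 0 < eulerZ Q (natc M.dimv) (natc N.dimv)) :
    ∃ (f : RHom M N) (v : Q.V) (x : M.space v), f.f v x ≠ 0 := by
  have h1 := euler_form M N
  have h2 : homDim M N ≠ 0 := by intro h0; rw [h0] at h1; push_cast at h1; omega
  unfold homDim at h2
  have h3 : 0 < Module.finrank k (LinearMap.ker (extMap M N)) := Nat.pos_of_ne_zero h2
  have := Module.nontrivial_of_finrank_pos h3
  obtain ⟨φ, hφ⟩ := exists_ne (0 : LinearMap.ker (extMap M N))
  refine ⟨(homEquiv M N).symm φ, ?_⟩
  by_contra! h4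
  refine hφ (Subtype.ext ?_)
  funext v
  exact LinearMap.ext fun x => h4 v x

theorem range_not_zero {M N : Repn k Q} (f : RHom M N) {v : Q.V} {x : M.space v}
    (h : f.f v x ≠ 0) : ¬ (rangeS f).repn.IsZero := fun h' =>
  h (congrArg Subtype.val (h' v ⟨f.f v x, x, rfl⟩))

theorem eulerZ_rnd_left (y0 : Q.V → ℕ) (m : ℕ) (g : G k (fun v => y0 v + m * δ v))
    (x : Q.V → ℤ) : eulerZ Q (natc (rnd (fun v => y0 v + m * δ v) g).dimv) x
      = eulerZ Q (natc y0) x + m * defectOf Q δ x := by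
  rw [dimv_rnd, natc_y, eulerZ_add_left, eulerZ_smul_left]
  rfl

theorem eulerZ_rnd_right (hA : Aff Q δ) (y0 : Q.V → ℕ) (m : ℕ)
    (g : G k (fun v => y0 v + m * δ v))
    (x : Q.V → ℤ) : eulerZ Q x (natc (rnd (fun v => y0 v + m * δ v) g).dimv)
      = eulerZ Q x (natc y0) - m * defectOf Q δ x := by
  rw [dimv_rnd, natc_y, eulerZ_add_right, eulerZ_smul_right, hA.anti]
  ring

theorem D_zero {M : Repn k Q} (h : M.IsZero) : D δ M = 0 := by
  unfold D; rw [zero_dimv h, defect_zero]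

theorem InP.neg {P : Repn k Q} (hP : InP δ P) (h : ¬ P.IsZero) : D δ P < 0 := by
  rw [← D_top]
  refine hP _ ?_
  by_contra! h'
  refine h fun v x => ?_
  have : x ∈ (topS P).sub v := Submodule.mem_top
  rw [h'] at this
  exact (Submodule.mem_bot k).1 this

theorem InI.pos {I : Repn k Q} (hI : InI δ I) (h : ¬ I.IsZero) : 0 < D δ I := by
  rw [← D_bot I]
  refine hI _ ?_
  by_contra! h'
  refine h fun v x => ?_
  have : x ∈ (⊤ : Submodule k (I.space v)) := Submodule.mem_top
  rw [← h'] at this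
  exact (Submodule.mem_bot k).1 this

theorem InJ.nonneg {J : Repn k Q} (hJ : InJ δ J) : 0 ≤ D δ J := by
  have := hJ (botS J)
  rwa [D_bot] at this

theorem InR.nonpos {J : Repn k Q} (hJ : InR δ J) : D δ J ≤ 0 := by
  have := hJ (topS J)
  rwa [D_top] at this

theorem extPJ [Finite k] (hA : Aff Q δ) (P : Repn k Q) [FD P] (hP : InP δ P) :
    ∀ (n : ℕ) (J : Repn k Q) [FD J], td J ≤ n → InJ δ J → ExtZero P J := by
  intro n
  induction n with
  | zero =>
    intro J _ hn _
    exact extZero_right_zero (td_zero (Nat.le_zero.1 hn))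
  | succ n ih =>
    intro J _ hn hJ
    by_cases hJ0 : J.IsZero
    · exact extZero_right_zero hJ0
    by_cases hP0 : P.IsZero
    · exact extZero_left_zero hP0
    have hD := hJ.nonneg
    obtain ⟨y0, hy0⟩ : ∃ y0 : Q.V → ℕ, 0 < eulerZ Q (natc y0) (natc J.dimv) := by
      rcases hD.lt_or_eq with h | h
      · exact ⟨δ, h⟩
      · rcases hA.pos_or J.dimv with h1 | ⟨m, hm⟩
        · exact ⟨_, h1⟩
        · refine ⟨P.dimv, ?_⟩
          have h2 := hP.neg hP0
          unfold D at h2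
          rw [hm, eulerZ_smul_right, hA.anti]
          have h3 : m ≠ 0 := by
            rintro rfl
            apply hJ0
            apply td_zero
            unfold td
            refine Finset.sum_eq_zero fun v _ => ?_
            have := congrFun hm v
            simpa [natc] using this
          have : 0 < (m : ℤ) := by positivity
          exact mul_pos this (by linarith)
    obtain ⟨m, g, hg⟩ := exists_left hA P hP y0
    obtain ⟨f, v, x, hf⟩ := exists_hom (rnd _ g) J (by
      rw [eulerZ_rnd_left]
      have : 0 ≤ (m : ℤ) * defectOf Q δ (natc J.dimv) := mul_nonneg (by positivity) hD
      linarith)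
    have h1 := td_pos (range_not_zero f hf)
    have h2 := td_quot (rangeS f)
    refine extZero_mid_right (incl (rangeS f)) (incl_inj _) (proj (rangeS f)) (proj_surj _) ?_
      (extZero_quot (toRange f) (toRange_surj f) hg)
      (ih (rangeS f).quot (by omega) (hJ.quot _))
    intro v x hx
    exact ⟨⟨x, (proj_zero _ _ _).1 hx⟩, rfl⟩

theorem extRI [Finite k] (hA : Aff Q δ) (I : Repn k Q) [FD I] (hI : InI δ I) :
    ∀ (n : ℕ) (R : Repn k Q) [FD R], td R ≤ n → InR δ R → ExtZero R I := by
  intro n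
  induction n with
  | zero =>
    intro J _ hn _
    exact extZero_left_zero (td_zero (Nat.le_zero.1 hn))
  | succ n ih =>
    intro R _ hn hR
    by_cases hR0 : R.IsZero
    · exact extZero_left_zero hR0
    by_cases hI0 : I.IsZero
    · exact extZero_right_zero hI0
    have hD := hR.nonpos
    obtain ⟨y0, hy0⟩ : ∃ y0 : Q.V → ℕ, 0 < eulerZ Q (natc R.dimv) (natc y0) := by
      rcases hD.lt_or_eq with h | h
      · exact ⟨δ, by rw [hA.anti]; unfold D at h; linarith⟩
      · rcases hA.pos_or R.dimv with h1 | ⟨m, hm⟩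
        · exact ⟨_, h1⟩
        · refine ⟨I.dimv, ?_⟩
          have h2 := hI.pos hI0
          unfold D at h2
          rw [hm, eulerZ_smul_left]
          have h3 : m ≠ 0 := by
            rintro rfl
            apply hR0
            apply td_zero
            unfold td
            refine Finset.sum_eq_zero fun v _ => ?_
            have := congrFun hm v
            simpa [natc] using this
          have : 0 < (m : ℤ) := by positivity
          exact mul_pos this h2
    obtain ⟨m, g, hg⟩ := exists_right hA I hI y0
    obtain ⟨f, v, x, hf⟩ := exists_hom R (rnd _ g) (by
      rw [eulerZ_rnd_right hA]
      have : 0 ≤ (m : ℤ) * -defectOf Q δ (natc R.dimv) :=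
        mul_nonneg (by positivity) (by unfold D at hD; linarith)
      linarith)
    have h1 := td_pos (range_not_zero f hf)
    have h2 := td_ker f
    refine extZero_mid_left (incl (kerS f)) (incl_inj _) (toRange f) (toRange_surj f) ?_
      (ih (kerS f).repn (by omega) (hR.of_inj _ (incl_inj _)))
      (extZero_sub (incl (rangeS f)) (incl_inj _) hg)
    intro v x hx
    exact ⟨⟨x, congrArg Subtype.val hx⟩, rfl⟩

/-! ### Classification of indecomposables -/

theorem InI.inJ {M : Repn k Q} (h : InI δ M) : InJ δ M := by
  intro U
  by_cases hU : ∃ v, U.sub v ≠ ⊤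
  · exact (h U hU).le
  · push Not at hU
    have : U = topS M := Subrep_ext hU
    rw [this, D_top]

theorem td_map {M N : Repn k Q} (g : RHom M N) (hg : ∀ v, Function.Injective (g.f v))
    (U : Subrep M) : td (mapS g U).repn = td U.repn := by
  unfold td
  refine Finset.sum_congr rfl fun v _ => ?_
  have := congrFun (vec_map g hg U) v
  simp only [natc] at this
  exact_mod_cast this

theorem td_comap {M : Repn k Q} [FD M] (U : Subrep M) (W : Subrep U.quot) :
    td (comapS (proj U) W).repn = td U.repn + td W.repn :=
  (td_of_natc (vec_comap U W).symm).symm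

theorem td_sub_pos {M : Repn k Q} [FD M] {U : Subrep M} (h : ∃ v, U.sub v ≠ ⊥) :
    0 < td U.repn := by
  apply td_pos
  rw [isZero_repn]
  push Not
  exact h

theorem td_sub_lt {M : Repn k Q} [FD M] {U : Subrep M} (h : ∃ v, U.sub v ≠ ⊤) :
    td U.repn < td M := by
  have : 0 < td U.quot := by
    apply td_pos
    rw [isZero_quot]
    push Not
    exact h
  have := td_quot U
  omega

theorem indec_P_or_J [Finite k] (hA : Aff Q δ) (N : Repn k Q) [FD N] (hN : N.Indec) :
    InP δ N ∨ InJ δ N := by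
  have : Nonempty (Subrep N) := ⟨botS N⟩
  obtain ⟨U, hU⟩ := Finite.exists_max
    (fun U : Subrep N => toLex (D δ U.repn, (td U.repn : ℤ)))
  have hU1 : ∀ W : Subrep N, D δ W.repn ≤ D δ U.repn := by
    intro W
    rcases Prod.Lex.toLex_le_toLex.1 (hU W) with h | h
    · exact le_of_lt h
    · exact h.1.le
  have hU2 : ∀ W : Subrep N, D δ W.repn = D δ U.repn → td W.repn ≤ td U.repn := by
    intro W hW
    rcases Prod.Lex.toLex_le_toLex.1 (hU W) with h | h
    · simp only at h; omega
    · have := h.2; simp only at this; omega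
  have hJ : InJ δ U.repn := fun W => by
    rw [← D_map (incl U) (incl_inj U)]; exact hU1 _
  have hP : InP δ U.quot := by
    intro W hW
    have h1 := hU1 (comapS (proj U) W)
    have h2 := hU2 (comapS (proj U) W)
    rw [D_comap] at h1 h2
    rw [td_comap] at h2
    have h3 := td_sub_pos hW
    by_contra! h4
    have := h2 (by omega)
    omega
  rcases indec_split hN U (extPJ hA U.quot hP _ U.repn le_rfl hJ) with h | h
  · left
    refine hP.of_inj (proj U) fun v => ?_
    rw [← LinearMap.ker_eq_bot, ← h v]
    exact Submodule.ker_mkQ _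
  · right
    intro W
    have h5 : U = topS N := Subrep_ext h
    have := hU1 W
    rwa [h5, D_top] at this

theorem indec_I_or [Finite k] (hA : Aff Q δ) (N : Repn k Q) [FD N] (hN : N.Indec) :
    InI δ N ∨ InR δ N := by
  have : Nonempty (Subrep N) := ⟨botS N⟩
  obtain ⟨U, hU⟩ := Finite.exists_max
    (fun U : Subrep N => toLex (D δ U.repn, -(td U.repn : ℤ)))
  have hU1 : ∀ W : Subrep N, D δ W.repn ≤ D δ U.repn := by
    intro W
    rcases Prod.Lex.toLex_le_toLex.1 (hU W) with h | h
    · exact le_of_lt h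
    · exact h.1.le
  have hU2 : ∀ W : Subrep N, D δ W.repn = D δ U.repn → td U.repn ≤ td W.repn := by
    intro W hW
    rcases Prod.Lex.toLex_le_toLex.1 (hU W) with h | h
    · simp only at h; omega
    · have := h.2; simp only at this; omega
  have hI : InI δ U.repn := by
    intro W hW
    have h1 := hU1 (mapS (incl U) W)
    have h2 := hU2 (mapS (incl U) W)
    rw [D_map (incl U) (incl_inj U)] at h1 h2
    rw [td_map (incl U) (incl_inj U)] at h2
    have h3 := td_sub_lt hW
    by_contra! h4
    have := h2 (by omega)
    omega
  have hR : InR δ U.quot := by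
    intro W
    have h1 := hU1 (comapS (proj U) W)
    rw [D_comap] at h1
    omega
  rcases indec_split hN U (extRI hA U.repn hI _ U.quot le_rfl hR) with h | h
  · right
    refine hR.of_inj (proj U) fun v => ?_
    rw [← LinearMap.ker_eq_bot, ← h v]
    exact Submodule.ker_mkQ _
  · left
    have h5 : U = topS N := Subrep_ext h
    intro W hW
    have h6 := td_sub_lt hW
    have h7 := hU1 W
    have h8 := hU2 W
    have h9 : td U.repn = td N := by
      have := td_quot U
      have h10 : td U.quot = 0 := by
        by_contra h11
        have := zero_dimv ((isZero_quot U).2 h)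
        apply h11
        unfold td
        refine Finset.sum_eq_zero fun v _ => ?_
        simpa [natc] using congrFun this v
      omega
    rw [h5, D_top] at h7 h8
    rw [← h5] at h8
    by_contra! h11
    have := h8 (by omega)
    omega

theorem indec_neg [Finite k] (hA : Aff Q δ) (N : Repn k Q) [FD N] (hN : N.Indec)
    (h : D δ N < 0) : InP δ N := by
  rcases indec_P_or_J hA N hN with h1 | h1
  · exact h1
  · have := h1.nonneg; omega

theorem indec_zero [Finite k] (hA : Aff Q δ) (N : Repn k Q) [FD N] (hN : N.Indec)
    (h : D δ N = 0) : InR δ N := by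
  rcases indec_P_or_J hA N hN with h1 | h1
  · have := h1.neg hN.1; omega
  · intro U; rw [← h]; exact h1 U

theorem indec_pos [Finite k] (hA : Aff Q δ) (N : Repn k Q) [FD N] (hN : N.Indec)
    (h : 0 < D δ N) : InI δ N := by
  rcases indec_I_or hA N hN with h1 | h1
  · exact h1
  · have := h1.nonpos; omega

theorem defect_sum {ι : Type} (s : Finset ι) (x : ι → Q.V → ℤ) :
    defectOf Q δ (∑ i ∈ s, x i) = ∑ i ∈ s, defectOf Q δ (x i) := by
  classical
  induction s using Finset.induction_on with
  | empty => simp [defect_zero]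
  | insert a s ha ih => rw [Finset.sum_insert ha, Finset.sum_insert ha, defect_add, ih]

instance {ι : Type} [Fintype ι] (Xi : ι → Repn k Q) [∀ i, FD (Xi i)] :
    FD (Repn.dsumFam Xi) :=
  ⟨fun v => inferInstanceAs (FiniteDimensional k (∀ i, (Xi i).space v))⟩

theorem D_dsumFam {ι : Type} [Fintype ι] (Xi : ι → Repn k Q) [∀ i, FD (Xi i)] :
    D δ (Repn.dsumFam Xi) = ∑ i, D δ (Xi i) := by
  unfold D
  rw [← defect_sum]
  congr 1
  funext v
  change ((Module.finrank k (∀ i, (Xi i).space v) : ℕ) : ℤ) = _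
  rw [Module.finrank_pi_fintype]
  simp [natc, Repn.dimv]

/-- projection to a summand -/
def projFam {ι : Type} (Xi : ι → Repn k Q) (j : ι) : RHom (Repn.dsumFam Xi) (Xi j) where
  f v := LinearMap.proj j
  comm _ _ := rfl

/-- composition -/
def rcomp {A B C : Repn k Q} (g : RHom B C) (f : RHom A B) : RHom A C where
  f v := (g.f v).comp (f.f v)
  comm a x := by
    change g.f _ (f.f _ (A.map a x)) = C.map a (g.f _ (f.f _ x))
    rw [f.comm, g.comm]

theorem InR_dsumFam {ι : Type} [Fintype ι] (Xi : ι → Repn k Q) [∀ i, FD (Xi i)]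
    (h : ∀ i, InR δ (Xi i)) : InR δ (Repn.dsumFam Xi) := by
  classical
  have key : ∀ (s : Finset ι) (U : Subrep (Repn.dsumFam Xi)),
      (∀ v, ∀ x ∈ U.sub v, ∀ i, i ∉ s → (projFam Xi i).f v x = 0) → D δ U.repn ≤ 0 := by
    intro s
    induction s using Finset.induction_on with
    | empty =>
      intro U hU
      refine (D_zero ((isZero_repn U).2 fun v => ?_)).le
      rw [Submodule.eq_bot_iff]
      intro x hx
      funext i
      exact hU v x hx i (Finset.notMem_empty i)
    | insert j s hj ih =>
      intro U hU
      let g := rcomp (projFam Xi j) (incl U)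
      have h1 := D_ker (δ := δ) g
      have h2 := h j (rangeS g)
      have h3 := ih (mapS (incl U) (kerS g)) (by
        rintro v _ ⟨x, hx, rfl⟩ i hi
        by_cases hij : i = j
        · subst hij
          exact hx
        · exact hU v _ x.2 i (by simp [hij, hi]))
      rw [D_map _ (incl_inj U)] at h3
      omega
  intro U
  exact key Finset.univ U (fun v x _ i hi => absurd (Finset.mem_univ i) hi)

theorem regular_inR [Finite k] (hA : Aff Q δ) (X : Repn k Q) (h : IsRegularModule δ X) :
    InR δ X ∧ D δ X = 0 := by
  obtain ⟨ι, _, Xi, h1, ⟨e⟩⟩ := h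
  have : ∀ i, FD (Xi i) := fun i => ⟨(h1 i).2.1⟩
  constructor
  · exact (InR_dsumFam Xi fun i => indec_zero hA _ (h1 i).1 (h1 i).2.2).of_inj
      ⟨fun v => (e.e v).toLinearMap, e.comm⟩ (fun v => (e.e v).injective)
  · have : D δ X = D δ (Repn.dsumFam Xi) := by
      unfold D; rw [vec_iso e]
    rw [this, D_dsumFam]
    exact Finset.sum_eq_zero fun i _ => (h1 i).2.2

/-! ### Indecomposables of defect `-1` -/

/-- zero homomorphism -/
def rzero (M N : Repn k Q) : RHom M N := ⟨fun _ => 0, fun a x => by simp⟩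

theorem rhom_ne_zero {M N : Repn k Q} (f : RHom M N) (h : f ≠ rzero M N) :
    ∃ v x, f.f v x ≠ 0 := by
  by_contra! h'
  exact h (RHom.ext' h')

theorem brick_inj {N : Repn k Q} [FD N] (hP : InP δ N) (hD : D δ N = -1) (f : RHom N N)
    (h : f ≠ rzero N N) (v : Q.V) : Function.Injective (f.f v) := by
  obtain ⟨w, x, hx⟩ := rhom_ne_zero f h
  rw [← LinearMap.ker_eq_bot]
  by_contra h1
  have h2 := hP (kerS f) ⟨v, h1⟩
  have h3 := hP (rangeS f) ⟨w, fun h4 => hx (by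
    have : f.f w x ∈ (rangeS f).sub w := ⟨x, rfl⟩
    rw [h4] at this
    exact (Submodule.mem_bot k).1 this)⟩
  have h4 := D_ker (δ := δ) f
  omega

/-- a bijective homomorphism is an isomorphism -/
noncomputable def mkIso {M N : Repn k Q} (f : RHom M N) (h : ∀ v, Function.Bijective (f.f v)) :
    Repn.Iso M N where
  e v := LinearEquiv.ofBijective (f.f v) (h v)
  comm a x := f.comm a x

theorem mkIso_apply {M N : Repn k Q} (f : RHom M N) (h : ∀ v, Function.Bijective (f.f v))
    (v : Q.V) (x : M.space v) : (mkIso f h).e v x = f.f v x := rfl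

/-- underlying homomorphism -/
def isoHom {M N : Repn k Q} (e : Repn.Iso M N) : RHom M N :=
  ⟨fun v => (e.e v).toLinearMap, e.comm⟩

theorem iso_ext {M N : Repn k Q} {e e' : Repn.Iso M N} (h : ∀ v x, e.e v x = e'.e v x) :
    e = e' := by
  cases e; cases e'
  congr
  funext v
  exact LinearEquiv.ext (h v)

/-- inverse isomorphism -/
def isoSymm {M N : Repn k Q} (e : Repn.Iso M N) : Repn.Iso N M where
  e v := (e.e v).symm
  comm a x := by
    rw [LinearEquiv.symm_apply_eq, e.comm, LinearEquiv.apply_symm_apply]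

/-- composition of isomorphisms -/
def isoTrans {M N L : Repn k Q} (e : Repn.Iso M N) (e' : Repn.Iso N L) : Repn.Iso M L where
  e v := (e.e v).trans (e'.e v)
  comm a x := by
    simp only [LinearEquiv.trans_apply]
    rw [e.comm, e'.comm]

theorem brick_bij {N : Repn k Q} [FD N] (hP : InP δ N) (hD : D δ N = -1) (f : RHom N N)
    (h : f ≠ rzero N N) (v : Q.V) : Function.Bijective (f.f v) :=
  ⟨brick_inj hP hD f h v, LinearMap.injective_iff_surjective.1 (brick_inj hP hD f h v)⟩

/-- multiplication of an extension by an endomorphism -/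
noncomputable def extPush {N : Repn k Q} (ξ : ∀ a : Q.A, N.space (Q.s a) →ₗ[k] N.space (Q.t a)) :
    (∀ v, N.space v →ₗ[k] N.space v) →ₗ[k]
      (∀ a : Q.A, N.space (Q.s a) →ₗ[k] N.space (Q.t a)) where
  toFun φ := fun a => (φ (Q.t a)).comp (ξ a)
  map_add' _ _ := rfl
  map_smul' _ _ := rfl

theorem brick_ext (hA : Aff Q δ) {N : Repn k Q} [FD N] (hP : InP δ N) (hD : D δ N = -1) :
    ExtZero N N := by
  intro ξ
  have h1 := euler_form N N
  have h2 : 0 < eulerZ Q (natc N.dimv) (natc N.dimv) :=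
    hA.pos N.dimv (by unfold D at hD; rw [hD]; decide)
  have h3 : extDim N N < homDim N N := by omega
  let T := (LinearMap.range (extMap N N)).mkQ.comp
    ((extPush ξ).comp (LinearMap.ker (extMap N N)).subtype)
  have h4 : LinearMap.ker T ≠ ⊥ := LinearMap.ker_ne_bot_of_finrank_lt h3
  obtain ⟨α, hα, hα0⟩ := (Submodule.ne_bot_iff _).1 h4
  have h5 : (extPush ξ) α.1 ∈ LinearMap.range (extMap N N) :=
    (Submodule.Quotient.mk_eq_zero _).1 (LinearMap.mem_ker.1 hα)
  obtain ⟨φ, hφ⟩ := h5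
  let f := (homEquiv N N).symm α
  have hf : f ≠ rzero N N := by
    intro h
    apply hα0
    apply Subtype.ext
    funext v
    exact congrArg (fun g : RHom N N => g.f v) h
  let e := mkIso f (brick_bij hP hD f hf)
  refine ⟨fun v => ((isoSymm e).e v).toLinearMap.comp (φ v), ?_⟩
  funext a
  refine LinearMap.ext fun x => ?_
  have h6 : N.map a (φ _ x) - φ _ (N.map a x) = e.e _ (ξ a x) := by
    rw [← extMap_apply', hφ]; rfl
  rw [extMap_apply']
  simp only [LinearMap.comp_apply, LinearEquiv.coe_coe]
  rw [← (isoSymm e).comm, ← map_sub, h6]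
  exact (e.e _).symm_apply_apply _

instance [Finite k] (M N : Repn k Q) [FD M] [FD N] : Finite (Repn.Iso M N) :=
  Finite.of_injective (fun e => isoHom e) fun e e' h =>
    iso_ext fun v x => congrArg (fun g : RHom M N => g.f v x) h

theorem brick_card [Finite k] (hA : Aff Q δ) {N : Repn k Q} [FD N] (hP : InP δ N)
    (hD : D δ N = -1) :
    (autCard N + 1 : ℕ) = Nat.card k ^ (titsZ Q (natc N.dimv)).toNat := by
  have h0 : ¬ N.IsZero := fun h => by rw [D_zero h] at hD; omega
  have h1 := euler_form N N
  rw [(extZero_iff N N).1 (brick_ext hA hP hD)] at h1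
  have h2 : (titsZ Q (natc N.dimv)).toNat = homDim N N := by
    unfold titsZ; omega
  rw [h2, ← card_rhom]
  unfold autCard
  rw [← Finite.card_option]
  refine Nat.card_eq_of_bijective
    (fun o : Option (Repn.Iso N N) => o.elim (rzero N N) isoHom) ⟨?_, ?_⟩
  · have h3 : ∀ e : Repn.Iso N N, isoHom e ≠ rzero N N := by
      intro e he
      refine h0 fun v x => (e.e v).injective ?_
      rw [map_zero]
      exact congrArg (fun g : RHom N N => g.f v x) he
    rintro (_ | e) (_ | e') h
    · rfl
    · exact absurd h.symm (h3 e')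
    · exact absurd h (h3 e)
    · exact congrArg some (iso_ext fun v x => congrArg (fun g : RHom N N => g.f v x) h)
  · intro f
    by_cases hf : f = rzero N N
    · exact ⟨none, hf.symm⟩
    · exact ⟨some (mkIso f (brick_bij hP hD f hf)), RHom.ext' fun v x => rfl⟩

theorem autCard_pos [Finite k] (N : Repn k Q) [FD N] : 0 < autCard N := by
  have : Nonempty (Repn.Iso N N) := ⟨⟨fun v => LinearEquiv.refl k _, fun a x => rfl⟩⟩
  exact Nat.card_pos

theorem uniqueI (hA : Aff Q δ) {A B : Repn k Q} [FD A] [FD B] (hIA : InI δ A) (hIB : InI δ B)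
    (hD : D δ A = 1) (hdim : A.dimv = B.dimv) : Nonempty (Repn.Iso A B) := by
  have hDB : D δ B = 1 := by unfold D at *; rw [← hdim]; exact hD
  obtain ⟨f, v, x, hx⟩ := exists_hom A B (by
    rw [← hdim]
    exact hA.pos A.dimv (by unfold D at hD; rw [hD]; decide))
  have h1 := hIA (kerS f) ⟨v, fun h => hx (by
    have : x ∈ (⊤ : Submodule k (A.space v)) := Submodule.mem_top
    rw [← h] at this
    exact this)⟩
  have h2 := D_ker (δ := δ) f
  have h3 : ∀ v, (rangeS f).sub v = ⊤ := by
    by_contra! h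
    have := hIB _ h
    omega
  have h4 : ∀ v, Function.Surjective (f.f v) := fun v => LinearMap.range_eq_top.1 (h3 v)
  exact ⟨mkIso f fun v => ⟨(LinearMap.injective_iff_surjective_of_finrank_eq_finrank
    (congrFun hdim v)).2 (h4 v), h4 v⟩⟩

/-! ### Counting -/

theorem moebius {A B R : Type} [Finite A] [Finite B] [Finite R] [PartialOrder R]
    (f : A → R) (g : B → R)
    (h : ∀ y, Nat.card {a // f a ≤ y} = Nat.card {b // g b ≤ y}) :
    ∀ y, Nat.card {a // f a = y} = Nat.card {b // g b = y} := by
  classical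
  have := Fintype.ofFinite A
  have := Fintype.ofFinite B
  have := Fintype.ofFinite R
  have key : ∀ {C : Type} [Fintype C] (u : C → R) (y : R), Nat.card {c // u c ≤ y}
      = Nat.card {c // u c = y} + ∑ z ∈ Finset.univ.filter (· < y), Nat.card {c // u c = z} := by
    intro C _ u y
    simp only [Nat.card_eq_fintype_card, Fintype.card_subtype]
    rw [Finset.card_eq_sum_card_fiberwise (f := u) (t := Finset.univ.filter (· ≤ y))
      (by intro c hc; simpa using hc)]
    have : Finset.univ.filter (· ≤ y) = insert y (Finset.univ.filter (· < y)) := by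
      ext z; simp [le_iff_eq_or_lt]
    rw [this, Finset.sum_insert (by simp)]
    congr 1
    · congr 1; ext c; simp only [Finset.mem_filter, Finset.mem_univ, true_and]
      exact ⟨fun h => h.2, fun h => ⟨h.le, h⟩⟩
    · refine Finset.sum_congr rfl fun z hz => ?_
      congr 1; ext c; simp only [Finset.mem_filter, Finset.mem_univ, true_and] at hz ⊢
      exact ⟨fun h => h.2, fun h => ⟨h ▸ hz.le, h⟩⟩
  intro y
  induction y using WellFoundedLT.induction with
  | ind y ih =>
    have h1 := h y
    rw [key, key] at h1
    rw [Finset.sum_congr rfl (g := fun z => Nat.card {b // g b = z})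
      (fun z hz => ih z (Finset.mem_filter.1 hz).2)] at h1
    omega

instance (X : Repn k Q) : PartialOrder (Subrep X) :=
  PartialOrder.lift (fun U => U.sub) (fun _ _ h => Subrep_ext fun v => congrFun h v)

/-- intersection -/
def infS {X : Repn k Q} (U W : Subrep X) : Subrep X where
  sub v := U.sub v ⊓ W.sub v
  stable a := by
    rintro _ ⟨x, hx, rfl⟩
    exact ⟨U.stable a ⟨x, hx.1, rfl⟩, W.stable a ⟨x, hx.2, rfl⟩⟩

/-- sum -/
def supS {X : Repn k Q} (U W : Subrep X) : Subrep X where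
  sub v := U.sub v ⊔ W.sub v
  stable a := by
    rw [Submodule.map_sup]
    exact sup_le_sup (U.stable a) (W.stable a)

theorem D_infS {X : Repn k Q} [FD X] (U W : Subrep X) :
    D δ (supS U W).repn + D δ (infS U W).repn = D δ U.repn + D δ W.repn := by
  unfold D
  rw [← defect_add, ← defect_add]
  congr 1
  funext v
  have := Submodule.finrank_sup_add_finrank_inf_eq (U.sub v) (W.sub v)
  change ((Module.finrank k (U.sub v ⊔ W.sub v : Submodule k (X.space v)) : ℕ) : ℤ)
    + ((Module.finrank k (U.sub v ⊓ W.sub v : Submodule k (X.space v)) : ℕ) : ℤ)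
    = ((Module.finrank k (U.sub v) : ℕ) : ℤ) + ((Module.finrank k (W.sub v) : ℕ) : ℤ)
  exact_mod_cast this

theorem infS_regular {X : Repn k Q} [FD X] (hX : InR δ X) (U W : Subrep X)
    (hU : D δ U.repn = 0) (hW : D δ W.repn = 0) : D δ (infS U W).repn = 0 := by
  have h1 := D_infS (δ := δ) U W
  have h2 := hX (supS U W)
  have h3 := hX (infS U W)
  omega

theorem td_mono_eq {X : Repn k Q} [FD X] {U W : Subrep X} (h : U ≤ W)
    (ht : td W.repn ≤ td U.repn) : U = W := by
  have h1 : ∀ v, U.repn.dimv v ≤ W.repn.dimv v := fun v => Submodule.finrank_mono (h v)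
  have h2 : td U.repn = td W.repn := le_antisymm (Finset.sum_le_sum fun v _ => h1 v) ht
  have h3 := (Finset.sum_eq_sum_iff_of_le fun v _ => h1 v).1 h2
  exact Subrep_ext fun v => Submodule.eq_of_le_of_finrank_eq (h v) (h3 v (Finset.mem_univ v))

/-- Regular subobjects of `X`. -/
abbrev Reg (δ : Q.V → ℕ) (X : Repn k Q) : Type := {W : Subrep X // D δ W.repn = 0}

theorem exists_hull [Finite k] {X : Repn k Q} [FD X] (hX : InR δ X) (hX0 : D δ X = 0)
    (U : Subrep X) : ∃ H : Reg δ X, U ≤ H.1 ∧ ∀ W : Reg δ X, U ≤ W.1 ↔ H ≤ W := by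
  have : Nonempty {W : Reg δ X // U ≤ W.1} :=
    ⟨⟨⟨topS X, by rw [D_top]; exact hX0⟩, fun v => le_top⟩⟩
  obtain ⟨H, hH⟩ := Finite.exists_min (fun W : {W : Reg δ X // U ≤ W.1} => td W.1.1.repn)
  refine ⟨H.1, H.2, fun W => ⟨fun hW => ?_, fun hW => H.2.trans hW⟩⟩
  have h1 := hH ⟨⟨infS H.1.1 W.1, infS_regular hX _ _ H.1.2 W.2⟩, fun v => le_inf (H.2 v) (hW v)⟩
  have h2 : infS H.1.1 W.1 ≤ H.1.1 := fun v => inf_le_left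
  have h3 := td_mono_eq h2 h1
  intro v
  have h4 : (infS H.1.1 W.1).sub v ≤ W.1.sub v := inf_le_right
  rw [h3] at h4
  exact h4

/-- homomorphisms into a subrepresentation -/
def homSub (N : Repn k Q) {X : Repn k Q} (Y : Subrep X) :
    {f : RHom N X // rangeS f ≤ Y} ≃ RHom N Y.repn where
  toFun f := ⟨fun v => (f.1.f v).codRestrict (Y.sub v) fun x => f.2 v ⟨x, rfl⟩,
    fun a x => Subtype.ext (f.1.comm a x)⟩
  invFun g := ⟨rcomp (incl Y) g, by
    rintro v _ ⟨x, rfl⟩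
    exact (g.f v x).2⟩
  left_inv f := Subtype.ext (RHom.ext' fun v x => rfl)
  right_inv g := RHom.ext' fun v x => rfl

theorem card_hom_reg [Finite k] (hA : Aff Q δ) {X : Repn k Q} [FD X] (hX : InR δ X)
    (N : Repn k Q) [FD N] (hP : InP δ N) (Y : Reg δ X) :
    Nat.card {f : RHom N X // rangeS f ≤ Y.1}
      = Nat.card k ^ (eulerZ Q (natc N.dimv) (natc Y.1.repn.dimv)).toNat := by
  have hJ : InJ δ Y.1.repn := by
    intro U
    rw [Y.2]
    exact hX.of_inj (incl Y.1) (incl_inj _) U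
  rw [Nat.card_congr (homSub N Y.1), card_rhom]
  have h1 := euler_form N Y.1.repn
  rw [(extZero_iff _ _).1 (extPJ hA N hP _ Y.1.repn le_rfl hJ)] at h1
  congr 1
  omega

/-- homomorphisms whose image lies in no proper regular subobject -/
def Full (δ : Q.V → ℕ) {N X : Repn k Q} (f : RHom N X) : Prop :=
  ∀ W : Subrep X, D δ W.repn = 0 → rangeS f ≤ W → W = topS X

theorem card_full [Finite k] (hA : Aff Q δ) {X : Repn k Q} [FD X] (hX : InR δ X)
    (hX0 : D δ X = 0) (N N' : Repn k Q) [FD N] [FD N'] (hP : InP δ N) (hP' : InP δ N')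
    (hdim : natc N'.dimv = natc N.dimv + natc δ) :
    Nat.card {f : RHom N X // Full δ f} = Nat.card {f : RHom N' X // Full δ f} := by
  choose H hH1 hH2 using fun U : Subrep X => exists_hull hX hX0 U
  let T : Reg δ X := ⟨topS X, by rw [D_top]; exact hX0⟩
  have h1 := moebius (fun f : RHom N X => H (rangeS f)) (fun f : RHom N' X => H (rangeS f))
    (fun Y => by
      simp only [← hH2]
      rw [card_hom_reg hA hX N hP, card_hom_reg hA hX N' hP', hdim, eulerZ_add_left]
      have : eulerZ Q (natc δ) (natc Y.1.repn.dimv) = 0 := Y.2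
      rw [this, add_zero]) T
  have h2 : ∀ (L : Repn k Q) (f : RHom L X), H (rangeS f) = T ↔ Full δ f := by
    intro L f
    constructor
    · intro h W hW hfW
      have h3 := (hH2 (rangeS f) ⟨W, hW⟩).1 hfW
      rw [h] at h3
      exact le_antisymm (fun v => le_top) h3
    · intro h
      exact Subtype.ext (h _ (H (rangeS f)).2 (hH1 _))
  simpa only [h2] using h1

theorem InI.of_iso {A B : Repn k Q} (e : Repn.Iso A B) (h : InI δ B) : InI δ A := by
  rintro U ⟨v, hv⟩
  have h1 : ∀ v, Function.Injective ((isoHom e).f v) := fun v => (e.e v).injective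
  have h2 : D δ A = D δ B := by unfold D; rw [vec_iso e]
  rw [← D_map (isoHom e) h1, h2]
  refine h _ ⟨v, fun h3 => hv ?_⟩
  rw [Submodule.eq_top_iff']
  intro x
  have : (e.e v) x ∈ (mapS (isoHom e) U).sub v := by rw [h3]; exact Submodule.mem_top
  obtain ⟨y, hy, hxy⟩ := this
  rwa [← h1 v hxy]

theorem hall_aut [Finite k] (hA : Aff Q δ) {X : Repn k Q} [FD X] (hX : InR δ X)
    (hX0 : D δ X = 0) (M N : Repn k Q) [FD M] [FD N] (hP : InP δ N) (hI : InI δ M)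
    (hN1 : D δ N = -1) (hM1 : D δ M = 1)
    (hdim : natc N.dimv + natc M.dimv = natc X.dimv) :
    hallNum M N X * autCard N = Nat.card {f : RHom N X // Full δ f} := by
  unfold hallNum autCard
  rw [← Nat.card_prod]
  -- the homomorphism attached to a pair
  let c : ∀ U : {U : Subrep X // Nonempty (Repn.Iso U.repn N) ∧ Nonempty (Repn.Iso U.quot M)},
    Repn.Iso U.1.repn N := fun U => U.2.1.some
  let F : ({U : Subrep X // Nonempty (Repn.Iso U.repn N) ∧ Nonempty (Repn.Iso U.quot M)}
      × Repn.Iso N N) → RHom N X := fun z =>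
    rcomp (incl z.1.1) (isoHom (isoTrans z.2 (isoSymm (c z.1))))
  have hF : ∀ z v x, (F z).f v x = (incl z.1.1).f v (((c z.1).e v).symm (z.2.e v x)) :=
    fun z v x => rfl
  have hFr : ∀ z, rangeS (F z) = z.1.1 := by
    intro z
    refine Subrep_ext fun v => le_antisymm ?_ ?_
    · rintro _ ⟨x, rfl⟩
      rw [hF]
      exact Subtype.prop (p := fun y => y ∈ z.1.1.sub v) _
    · intro y hy
      refine ⟨(z.2.e v).symm ((c z.1).e v ⟨y, hy⟩), ?_⟩
      rw [hF, LinearEquiv.apply_symm_apply]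
      exact congrArg ((incl z.1.1).f v) (((c z.1).e v).symm_apply_apply _)
  have hFfull : ∀ z, Full δ (F z) := by
    rintro ⟨⟨U, ⟨eN⟩, ⟨eM⟩⟩, σ⟩ W hW hle
    rw [hFr] at hle
    simp only at hle
    have hc : comapS (proj U) (mapS (proj U) W) = W := by
      refine Subrep_ext fun v => ?_
      change ((W.sub v).map (U.sub v).mkQ).comap (U.sub v).mkQ = W.sub v
      rw [Submodule.comap_map_mkQ]
      exact sup_eq_right.2 (hle v)
    have h1 := D_comap (δ := δ) U (mapS (proj U) W)
    have h2 : D δ U.repn = -1 := by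
      rw [← hN1]; unfold D; rw [vec_iso eN]
    have h3 : D δ U.quot = 1 := by
      rw [← hM1]; unfold D; rw [vec_iso eM]
    rw [hc, hW, h2] at h1
    have h4 : ∀ v, (mapS (proj U) W).sub v = ⊤ := by
      by_contra! h
      have := (hI.of_iso eM) _ h
      omega
    rw [← hc]
    refine Subrep_ext fun v => ?_
    change ((mapS (proj U) W).sub v).comap _ = ⊤
    rw [h4, Submodule.comap_top]
  refine Nat.card_eq_of_bijective (fun z => ⟨F z, hFfull z⟩) ⟨?_, ?_⟩
  · rintro ⟨U, σ⟩ ⟨U', σ'⟩ h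
    have h1 : F (U, σ) = F (U', σ') := congrArg Subtype.val h
    have h2 : U = U' := Subtype.ext (by
      have h3 := hFr (U, σ)
      rw [h1, hFr] at h3
      exact h3.symm)
    subst h2
    have h3 : σ = σ' := iso_ext fun v x => by
      have h4 : (F (U, σ)).f v x = (F (U, σ')).f v x := by rw [h1]
      rw [hF, hF] at h4
      exact ((c U).e v).symm.injective (incl_inj _ v h4)
    rw [h3]
  · rintro ⟨f, hf⟩
    have hM0 : ¬ M.IsZero := fun h => by rw [D_zero h] at hM1; omega
    have hinj : ∀ v, Function.Injective (f.f v) := by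
      by_contra! h
      obtain ⟨v, hv⟩ := h
      rw [← LinearMap.ker_eq_bot] at hv
      have h1 := hP (kerS f) ⟨v, hv⟩
      have h2 := D_ker (δ := δ) f
      have h3 := hX (rangeS f)
      have h4 := hf (rangeS f) (by omega) le_rfl
      have h5 := td_ker f
      have h6 := td_of_natc hdim
      have h7 := td_pos hM0
      have h8 : td (topS X).repn = td X := by
        have := td_of_natc (M := (topS X).repn) (N := (botS X).repn) (L := X)
          (by rw [vec_top, vec_bot, add_zero])
        have h9 : td (botS X).repn = 0 := by
          have := td_of_natc (M := (botS X).repn) (N := (botS X).repn) (L := (botS X).repn)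
            (by rw [vec_bot, add_zero])
          omega
        omega
      rw [h4] at h5
      omega
    have hbij : ∀ v, Function.Bijective ((toRange f).f v) := fun v =>
      ⟨fun x y hxy => hinj v (congrArg Subtype.val hxy), toRange_surj f v⟩
    let e := mkIso (toRange f) hbij
    have hv1 : (rangeS f).repn.dimv = N.dimv := (vec_iso e).symm
    have hDr : D δ (rangeS f).repn = -1 := by rw [← hN1]; unfold D; rw [hv1]
    have hDq := D_quot (δ := δ) (rangeS f)
    have hIq : InI δ (rangeS f).quot := by
      intro W hW
      have h1 := D_comap (δ := δ) (rangeS f) W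
      have h2 := hX (comapS (proj (rangeS f)) W)
      by_contra! h3
      have h4 := hf (comapS (proj (rangeS f)) W) (by omega) (by
        intro v x hx
        change (proj (rangeS f)).f v x ∈ W.sub v
        rw [(proj_zero (rangeS f) v x).2 hx]
        exact Submodule.zero_mem _)
      obtain ⟨v, hv⟩ := hW
      apply hv
      rw [Submodule.eq_top_iff']
      intro y
      obtain ⟨x, rfl⟩ := proj_surj (rangeS f) v y
      have : x ∈ (comapS (proj (rangeS f)) W).sub v := by rw [h4]; exact Submodule.mem_top
      exact this
    have hdq : (rangeS f).quot.dimv = M.dimv := by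
      have h1 := vec_quot (rangeS f)
      rw [← hdim, hv1] at h1
      have h2 := add_left_cancel h1
      funext v
      have := congrFun h2 v
      simp only [natc] at this
      exact_mod_cast this
    have hM := uniqueI hA hIq hI (by omega) hdq
    let U : {U : Subrep X // Nonempty (Repn.Iso U.repn N) ∧ Nonempty (Repn.Iso U.quot M)} :=
      ⟨rangeS f, ⟨isoSymm e⟩, hM⟩
    refine ⟨(U, isoTrans e (c U)), Subtype.ext (RHom.ext' fun v x => ?_)⟩
    change (F (U, isoTrans e (c U))).f v x = f.f v x
    rw [hF]
    exact congrArg ((incl (rangeS f)).f v) (((c U).e v).symm_apply_apply (e.e v x))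

theorem hall_zero {X M N : Repn k Q} [FD X] (h : natc N.dimv + natc M.dimv ≠ natc X.dimv) :
    hallNum M N X = 0 := by
  unfold hallNum
  have : IsEmpty {U : Subrep X // Nonempty (Repn.Iso U.repn N) ∧ Nonempty (Repn.Iso U.quot M)} := by
    refine ⟨?_⟩
    rintro ⟨U, ⟨e⟩, ⟨e'⟩⟩
    apply h
    rw [← vec_iso e, ← vec_iso e', vec_quot]
  exact Nat.card_of_isEmpty

theorem shift_aux [Finite k] (hA : Aff Q δ) {X : Repn k Q} [FD X] (hX : IsRegularModule δ X)
    (M N M' N' : Repn k Q) [FD M] [FD N] [FD M'] [FD N']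
    (hM : M.Indec) (hN : N.Indec) (hM' : M'.Indec) (hN' : N'.Indec)
    (hM1 : D δ M = 1) (hN1 : D δ N = -1)
    (hMd : natc M'.dimv + natc δ = natc M.dimv)
    (hNd : natc N'.dimv = natc N.dimv + natc δ) :
    hallNum M N X = hallNum M' N' X := by
  have hd : natc N'.dimv + natc M'.dimv = natc N.dimv + natc M.dimv := by
    rw [hNd, ← hMd]; abel
  by_cases hdim : natc N.dimv + natc M.dimv = natc X.dimv
  · have hδ0 : defectOf Q δ (natc δ) = 0 := hA.min.2.1
    have hN'1 : D δ N' = -1 := by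
      unfold D at *; rw [hNd, defect_add, hN1, hδ0, add_zero]
    have hM'1 : D δ M' = 1 := by
      unfold D at *; rw [← hMd, defect_add, hδ0, add_zero] at hM1; exact hM1
    obtain ⟨hXR, hX0⟩ := regular_inR hA X hX
    have hP := indec_neg hA N hN (by omega)
    have hP' := indec_neg hA N' hN' (by omega)
    have hI := indec_pos hA M hM (by omega)
    have hI' := indec_pos hA M' hM' (by omega)
    have h1 := hall_aut hA hXR hX0 M N hP hI hN1 hM1 hdim
    have h2 := hall_aut hA hXR hX0 M' N' hP' hI' hN'1 hM'1 (hd.trans hdim)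
    have h3 := card_full hA hXR hX0 N N' hP hP' hNd
    have h4 := brick_card hA hP hN1
    have h5 := brick_card hA hP' hN'1
    have h6 : titsZ Q (natc N'.dimv) = titsZ Q (natc N.dimv) := by
      rw [hNd]
      have h7 := hA.anti (natc N.dimv)
      have h8 := hA.min.2.1
      unfold titsZ at *
      unfold defectOf at h7
      rw [eulerZ_add_left, eulerZ_add_right, eulerZ_add_right, h8, h7]
      ring
    rw [h6, ← h4] at h5
    have h7 : autCard N' = autCard N := by omega
    rw [h7] at h2
    exact Nat.eq_of_mul_eq_mul_right (autCard_pos N) (by rw [h1, h2, h3])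
  · rw [hall_zero hdim, hall_zero (by rw [hd]; exact hdim)]

end HallShift

/-- **Lemma 10 ("shift") of the paper.**  Let `X` be a regular module, either
homogeneous or lying in a single non-homogeneous tube.  If `M` is an indecomposable
(preinjective) module with defect `∂(M) = 1` and `dim M > δ`, and `N` is an
indecomposable (preprojective) module with `∂(N) = −1`, then `F_{MN}^X = F_{M'N'}^X`,
where `M'` and `N'` are the indecomposables with `dim M' = dim M − δ` and
`dim N' = dim N + δ`. -/
theorem hall_number_shift
    (Q : QuiverData) (δ : Q.V → ℕ)
    (hQ : IsAffine Q) (hnc : ¬ IsOrientedCycle Q) (hδ : IsMinImagRoot Q δ)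
    (k : Type) [Field k] [Fintype k]
    (X : Repn k Q) (hXf : X.FinDim)
    (hX : IsHomogRegular δ X ∨ SingleNonHomogTube δ X)
    (M N : Repn k Q)
    (hM : M.Indec) (hMf : M.FinDim)
    (hMdef : defectOf Q δ (natc (Repn.dimv M)) = 1)
    (hMbig : (∀ v, δ v ≤ Repn.dimv M v) ∧ Repn.dimv M ≠ δ)
    (hN : N.Indec) (hNf : N.FinDim)
    (hNdef : defectOf Q δ (natc (Repn.dimv N)) = -1)
    (M' N' : Repn k Q)
    (hM' : M'.Indec) (hM'f : M'.FinDim)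
    (hM'dim : ∀ v, Repn.dimv M' v + δ v = Repn.dimv M v)
    (hN' : N'.Indec) (hN'f : N'.FinDim)
    (hN'dim : ∀ v, Repn.dimv N' v = Repn.dimv N v + δ v) :
    hallNum M N X = hallNum M' N' X := by
  haveI : HallShift.FD X := ⟨hXf⟩
  haveI : HallShift.FD M := ⟨hMf⟩
  haveI : HallShift.FD N := ⟨hNf⟩
  haveI : HallShift.FD M' := ⟨hM'f⟩
  haveI : HallShift.FD N' := ⟨hN'f⟩
  have hreg : IsRegularModule δ X := by
    rcases hX with ⟨ι, i1, Xi, h1, h2⟩ | ⟨ι, i1, Xi, h1, _, h2⟩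
    · exact ⟨ι, i1, Xi, fun i => (h1 i).1, h2⟩
    · exact ⟨ι, i1, Xi, fun i => (h1 i).1, h2⟩
  refine HallShift.shift_aux ⟨hQ.2.1, hδ⟩ hreg M N M' N' hM hN hM' hN' hMdef hNdef ?_ ?_
  · funext v
    have := hM'dim v
    simp only [natc, Pi.add_apply]
    exact_mod_cast this
  · funext v
    have := hN'dim v
    simp only [natc, Pi.add_apply]
    exact_mod_cast this
end

section
/- Let A be a finite-dimensional hereditary algebra over a finite field k with q elements and let M be an exceptional A-module. Then Aut(M^m) ≅ GL_m(k) for all m ≥ 1, and for all m ≥ 0 the Hall number satisfies F_{M M^m}^{M^{m+1}} = (q^{m+1} − 1)/(q − 1). -/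
open Matrix

section HallHelpers

variable {k A M : Type} [Field k] [Ring A] [Algebra k A] [AddCommGroup M] [Module A M]
  [Module k M] [IsScalarTower k A M]

/-- The map `M^n → M` attached to a vector of scalars. -/
def hallPhi [SMulCommClass A k M] {n : ℕ} (v : Fin n → k) : (Fin n → M) →ₗ[A] M where
  toFun x := ∑ i, v i • x i
  map_add' x y := by simp [Finset.sum_add_distrib]
  map_smul' a x := by
    simp only [Pi.smul_apply, RingHom.id_apply, Finset.smul_sum]
    exact Finset.sum_congr rfl fun i _ => smul_comm _ _ _

variable [SMulCommClass A k M]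

theorem hallPhi_apply {n : ℕ} (v : Fin n → k) (x : Fin n → M) :
    hallPhi (A := A) v x = ∑ i, v i • x i := rfl

theorem hallPhi_single {n : ℕ} (v : Fin n → k) (i : Fin n) (t : M) :
    hallPhi (A := A) v (Pi.single i t) = v i • t := by
  rw [hallPhi_apply, Finset.sum_eq_single i]
  · simp
  · intro j _ hj
    simp [hj]
  · simp

theorem hallPhi_surj {n : ℕ} (v : Fin n → k) (hv : v ≠ 0) :
    Function.Surjective (hallPhi (A := A) (M := M) v) := by
  obtain ⟨i, hi⟩ := Function.ne_iff.mp hv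
  intro t
  refine ⟨Pi.single i ((v i)⁻¹ • t), ?_⟩
  rw [hallPhi_single, smul_inv_smul₀ hi]

theorem hallPhi_ker {m : ℕ} (v : Fin (m+1) → k) (hv : v ≠ 0) :
    Nonempty (LinearMap.ker (hallPhi (A := A) (M := M) v) ≃ₗ[A] (Fin m → M)) := by
  obtain ⟨i, hi⟩ := Function.ne_iff.mp hv
  have hi : v i ≠ 0 := hi
  refine ⟨LinearEquiv.ofBijective
    ((LinearMap.funLeft A M i.succAbove).comp (Submodule.subtype _)) ⟨?_, ?_⟩⟩
  · rw [← LinearMap.ker_eq_bot, LinearMap.ker_eq_bot']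
    rintro ⟨x, hx⟩ h
    have h1 : ∀ j, x (i.succAbove j) = 0 := fun j => congrFun h j
    rw [LinearMap.mem_ker, hallPhi_apply, Fin.sum_univ_succAbove _ i] at hx
    simp only [h1, smul_zero, Finset.sum_const_zero, add_zero] at hx
    have h2 : x i = 0 := (smul_eq_zero_iff_right hi).mp hx
    ext j
    change x j = 0
    rcases Fin.eq_self_or_eq_succAbove i j with rfl | ⟨l, rfl⟩
    · exact h2
    · exact h1 l
  · intro y
    refine ⟨⟨Fin.insertNth (α := fun _ => M) i (-((v i)⁻¹ • ∑ j, v (i.succAbove j) • y j)) y, ?_⟩, ?_⟩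
    · rw [LinearMap.mem_ker, hallPhi_apply, Fin.sum_univ_succAbove _ i]
      simp [smul_inv_smul₀ hi]
    · ext j
      simp [LinearMap.funLeft]

theorem hallPhi_ker_inj [Nontrivial M] {n : ℕ} (v w : Fin n → k) (hv : v ≠ 0) (hw : w ≠ 0)
    (h : LinearMap.ker (hallPhi (A := A) (M := M) v) = LinearMap.ker (hallPhi (A := A) w)) :
    ∃ a : k, a • w = v := by
  obtain ⟨t, ht⟩ := exists_ne (0 : M)
  obtain ⟨j, hj⟩ := Function.ne_iff.mp hw
  have hj : w j ≠ 0 := hj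
  refine ⟨v j / w j, ?_⟩
  ext i
  have h1 : Pi.single i (w j • t) - Pi.single j (w i • t) ∈
      LinearMap.ker (hallPhi (A := A) (M := M) v) := by
    rw [h, LinearMap.mem_ker, map_sub, hallPhi_single, hallPhi_single, smul_comm, sub_self]
  rw [LinearMap.mem_ker, map_sub, hallPhi_single, hallPhi_single, smul_smul, smul_smul,
    ← sub_smul, smul_eq_zero_iff_left ht] at h1
  simp only [Pi.smul_apply, smul_eq_mul]
  field_simp
  linear_combination -h1

theorem hallPhi_ker_smul {n : ℕ} (v w : Fin n → k) (a : k) (ha : a ≠ 0) (h : v = a • w) :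
    LinearMap.ker (hallPhi (A := A) (M := M) v) = LinearMap.ker (hallPhi (A := A) w) := by
  ext x
  subst h
  simp [hallPhi_apply, mul_smul, ← Finset.smul_sum, ha]

theorem hall_exists (hEnd : ∀ f : M →ₗ[A] M, ∃ c : k, ∀ x, f x = c • x) {n : ℕ}
    (f : (Fin n → M) →ₗ[A] M) : ∃ v : Fin n → k, f = hallPhi v := by
  choose c hc using fun i => hEnd (f.comp (LinearMap.single A (fun _ => M) i))
  refine ⟨c, ?_⟩
  refine LinearMap.pi_ext fun i x => ?_
  rw [hallPhi_single, ← hc]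
  rfl

theorem hall_card [Fintype k] [Nontrivial M]
    (hEnd : ∀ f : M →ₗ[A] M, ∃ c : k, ∀ x, f x = c • x) (m : ℕ) :
    Nat.card {U : Submodule A (Fin (m+1) → M) //
          Nonempty (U ≃ₗ[A] (Fin m → M)) ∧
          Nonempty (((Fin (m+1) → M) ⧸ U) ≃ₗ[A] M)} =
    Nat.card (Projectivization k (Fin (m+1) → k)) := by
  symm
  refine Nat.card_eq_of_bijective (fun p => ⟨LinearMap.ker (hallPhi (A := A) p.rep),
    hallPhi_ker _ p.rep_nonzero,
    ⟨LinearMap.quotKerEquivOfSurjective _ (hallPhi_surj _ p.rep_nonzero)⟩⟩) ⟨?_, ?_⟩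
  · intro p q h
    have h := congrArg Subtype.val h
    rw [← p.mk_rep, ← q.mk_rep, Projectivization.mk_eq_mk_iff']
    exact hallPhi_ker_inj _ _ p.rep_nonzero q.rep_nonzero h
  · rintro ⟨U, hU, ⟨e⟩⟩
    obtain ⟨v, hv⟩ := hall_exists hEnd (e.toLinearMap.comp U.mkQ)
    have hker : LinearMap.ker (hallPhi (A := A) (M := M) v) = U := by
      rw [← hv, LinearEquiv.ker_comp, Submodule.ker_mkQ]
    have hsurj : Function.Surjective (hallPhi (A := A) (M := M) v) := by
      rw [← hv]
      exact e.surjective.comp U.mkQ_surjective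
    have hv0 : v ≠ 0 := by
      rintro rfl
      obtain ⟨t, ht⟩ := exists_ne (0 : M)
      obtain ⟨x, hx⟩ := hsurj t
      apply ht
      rw [← hx, hallPhi_apply]
      simp
    refine ⟨Projectivization.mk k v hv0, Subtype.ext ?_⟩
    obtain ⟨a, ha⟩ := Projectivization.exists_smul_eq_mk_rep k v hv0
    exact (hallPhi_ker_smul _ _ (a : k) a.ne_zero ha.symm).trans hker

theorem hall_end [Nontrivial M]
    (hEnd : ∀ f : M →ₗ[A] M, ∃ c : k, ∀ x, f x = c • x) (m : ℕ) :
    Nonempty ((((Fin m → M) ≃ₗ[A] (Fin m → M))) ≃* GL (Fin m) k) := by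
  have hb : Function.Bijective (Module.toModuleEnd A (S := k) M) := by
    refine ⟨RingHom.injective _, fun f => ?_⟩
    obtain ⟨c, hc⟩ := hEnd f
    exact ⟨c, LinearMap.ext fun x => (hc x).symm⟩
  let e : k ≃+* Module.End A M := RingEquiv.ofBijective _ hb
  exact ⟨(LinearMap.GeneralLinearGroup.generalLinearEquiv A (Fin m → M)).symm.trans
    (Units.mapEquiv ((endVecRingEquivMatrixEnd (Fin m) A M).trans
      e.symm.mapMatrix).toMulEquiv)⟩

end HallHelpers

/-- **Hall numbers for powers of an exceptional module** (Section 2 of the paper).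
Let `A` be a finite-dimensional hereditary algebra over a finite field `k` with `q`
elements and `M` an exceptional `A`-module (i.e. `End(M) ≅ k` and every self-extension
of `M` splits).  Then `Aut(M^m) ≅ GL_m(k)` for all `m ≥ 1` and
`F_{M M^m}^{M^{m+1}} = (q^{m+1} − 1)/(q − 1)` for all `m ≥ 0`. -/
theorem exceptional_module_hall_numbers
    (k : Type) [Field k] [Fintype k]
    (A : Type) [Ring A] [Algebra k A] [FiniteDimensional k A]
    (hered : ∀ (P : Type) [AddCommGroup P] [Module A P],
      Module.Projective A P → ∀ N : Submodule A P, Module.Projective A N)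
    (M : Type) [AddCommGroup M] [Module A M] [Module.Finite A M]
    (hEnd : ∀ f : M →ₗ[A] M, ∃ c : k, ∀ x, f x = algebraMap k A c • x)
    (hEndInj : ∀ c : k, (∀ x : M, algebraMap k A c • x = 0) → c = 0)
    (hExt : ∀ (E : Type) [AddCommGroup E] [Module A E] (f : M →ₗ[A] E) (g : E →ₗ[A] M),
      Function.Injective f → Function.Surjective g →
      LinearMap.range f = LinearMap.ker g →
      ∃ s : M →ₗ[A] E, g.comp s = LinearMap.id) :
    (∀ m : ℕ, 1 ≤ m →
      Nonempty ((((Fin m → M) ≃ₗ[A] (Fin m → M))) ≃* GL (Fin m) k)) ∧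
    (∀ m : ℕ,
      ((Fintype.card k : ℤ) - 1) *
        (Nat.card {U : Submodule A (Fin (m+1) → M) //
          Nonempty (U ≃ₗ[A] (Fin m → M)) ∧
          Nonempty (((Fin (m+1) → M) ⧸ U) ≃ₗ[A] M)} : ℤ)
        = (Fintype.card k : ℤ) ^ (m+1) - 1) := by
  
  letI : Module k M := Module.compHom M (algebraMap k A)
  haveI : IsScalarTower k A M := ⟨fun c a x => by
    change (c • a) • x = algebraMap k A c • (a • x)
    rw [Algebra.smul_def, mul_smul]⟩
  haveI : SMulCommClass A k M := ⟨fun a c x => by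
    change a • (algebraMap k A c • x) = algebraMap k A c • (a • x)
    rw [← mul_smul, ← mul_smul, Algebra.commutes]⟩
  haveI : Nontrivial M := by
    by_contra h
    rw [not_nontrivial_iff_subsingleton] at h
    exact one_ne_zero (hEndInj 1 fun x => Subsingleton.elim _ _)
  have hE : ∀ f : M →ₗ[A] M, ∃ c : k, ∀ x, f x = c • x := hEnd
  refine ⟨fun m _ => hall_end hE m, fun m => ?_⟩
  rw [hall_card hE m]
  have h := Projectivization.card k (Fin (m+1) → k)
  rw [Nat.card_fun, Nat.card_eq_fintype_card (α := k), Nat.card_eq_fintype_card (α := Fin (m+1)),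
    Fintype.card_fin] at h
  have h1 : 1 ≤ Fintype.card k := Fintype.card_pos
  have h2 : 1 ≤ Fintype.card k ^ (m+1) := Nat.one_le_pow _ _ h1
  zify [h1, h2] at h
  rw [h, mul_comm]
end

section
/- Let Q be a quiver, k a finite field with q elements, and (F,T) a split torsion pair on the set of indecomposable finite-dimensional kQ-modules. Let X be a finite-dimensional kQ-module with torsion part X_t (its unique submodule with X_t ∈ add T and X/X_t ∈ add F) and torsion-free part X_f = X/X_t, so X ≅ X_f ⊕ X_t. Then for every finite-dimensional kQ-module E one has F_{X_f X_t}^E = 1 if E ≅ X and F_{X_f X_t}^E = 0 otherwise; moreover |Aut(X)| = |Aut(X_f)| · |Aut(X_t)| · q^{⟨X_f, X_t⟩}. -/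
open Polynomial

section Torsion

variable {k : Type} [Field k] {Q : QuiverData}

/-- `M ∈ add P`: `M` is a finite direct sum of indecomposables from the class `P`. -/
def InAdd (P : Repn k Q → Prop) (M : Repn k Q) : Prop :=
  ∃ (ι : Type) (_ : Fintype ι) (Xi : ι → Repn k Q),
    (∀ i, P (Xi i) ∧ (Xi i).Indec) ∧ Nonempty (Repn.Iso M (Repn.dsumFam Xi))

/-- A split torsion pair: a decomposition of the indecomposable finite-dimensional
modules into classes `F ∪ T` with `Hom(T,F) = 0 = Ext¹(F,T)`. -/
def SplitTorsionPair (Fcl Tcl : Repn k Q → Prop) : Prop :=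
  (∀ M : Repn k Q, M.Indec → M.FinDim → (Fcl M ∨ Tcl M)) ∧
  (∀ M : Repn k Q, ¬ (Fcl M ∧ Tcl M)) ∧
  (∀ T F : Repn k Q, Tcl T → Fcl F → homDim T F = 0) ∧
  (∀ F T : Repn k Q, Fcl F → Tcl T → extDim F T = 0)

end Torsion

namespace STP

variable {k : Type} [Field k] {Q : QuiverData}

/-- A family of linear maps is a morphism of representations. -/
def IsHom (M N : Repn k Q) (f : ∀ v, M.space v →ₗ[k] N.space v) : Prop :=
  ∀ (a : Q.A) (x : M.space (Q.s a)), N.map a (f (Q.s a) x) = f (Q.t a) (M.map a x)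

theorem extMap_apply (M N : Repn k Q) (f : ∀ v, M.space v →ₗ[k] N.space v) (a : Q.A)
    (x : M.space (Q.s a)) :
    extMap M N f a x = N.map a (f (Q.s a) x) - f (Q.t a) (M.map a x) := rfl

theorem mem_ker_iff (M N : Repn k Q) (f : ∀ v, M.space v →ₗ[k] N.space v) :
    f ∈ LinearMap.ker (extMap M N) ↔ IsHom M N f := by
  rw [LinearMap.mem_ker]
  constructor
  · intro h a x
    have := congrArg (fun g => g x) (congrFun h a)
    exact sub_eq_zero.mp this
  · intro h
    funext a
    ext x
    exact sub_eq_zero.mpr (h a x)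

/-- Inverse isomorphism. -/
def isoSymm {M N : Repn k Q} (e : Repn.Iso M N) : Repn.Iso N M where
  e v := (e.e v).symm
  comm a x := by
    rw [LinearEquiv.symm_apply_eq, e.comm, LinearEquiv.apply_symm_apply]

/-- Composite isomorphism. -/
def isoTrans {M N P : Repn k Q} (e : Repn.Iso M N) (f : Repn.Iso N P) : Repn.Iso M P where
  e v := (e.e v).trans (f.e v)
  comm a x := by
    simp only [LinearEquiv.trans_apply]
    rw [e.comm, f.comm]

/-- Direct sum of isomorphisms. -/
def isoDsum {M N M' N' : Repn k Q} (e : Repn.Iso M M') (f : Repn.Iso N N') :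
    Repn.Iso (M.dsum N) (M'.dsum N') where
  e v := (e.e v).prodCongr (f.e v)
  comm a x := Prod.ext (e.comm a x.1) (f.comm a x.2)

theorem iso_ext {M N : Repn k Q} {e f : Repn.Iso M N} (h : ∀ v x, e.e v x = f.e v x) : e = f := by
  cases e with
  | mk e he =>
    cases f with
    | mk f hf =>
      congr 1
      funext v
      exact LinearEquiv.ext (h v)

/-- The decomposition data of a module in `add P`. -/
theorem inAdd_data {P : Repn k Q → Prop} {M : Repn k Q} (hM : M.FinDim) (h : InAdd P M) :
    ∃ (ι : Type) (_ : Fintype ι) (Xi : ι → Repn k Q)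
      (inc : ∀ i v, (Xi i).space v →ₗ[k] M.space v)
      (pr : ∀ i v, M.space v →ₗ[k] (Xi i).space v),
      (∀ i, P (Xi i)) ∧ (∀ i, (Xi i).FinDim) ∧ (∀ i, IsHom _ _ (inc i)) ∧
      (∀ i, IsHom _ _ (pr i)) ∧ ∀ v x, ∑ i, inc i v (pr i v x) = x := by
  classical
  obtain ⟨ι, hι, Xi, hP, ⟨e⟩⟩ := h
  let inc : ∀ i v, (Xi i).space v →ₗ[k] M.space v := fun i v =>
    (e.e v).symm.toLinearMap.comp (LinearMap.single k (fun i => (Xi i).space v) i)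
  let pr : ∀ i v, M.space v →ₗ[k] (Xi i).space v := fun i v =>
    (LinearMap.proj (R := k) (φ := fun i => (Xi i).space v) i).comp (e.e v).toLinearMap
  refine ⟨ι, hι, Xi, inc, pr, fun i => (hP i).1, ?_, ?_, ?_, ?_⟩
  · intro i v
    have := hM v
    refine Module.Finite.of_injective (inc i v) ?_
    exact (e.e v).symm.injective.comp (Pi.single_injective (M := fun i => (Xi i).space v) i)
  · intro i a x
    have h1 := (isoSymm e).comm a (Pi.single (M := fun i => (Xi i).space (Q.s a)) i x)
    refine h1.symm.trans ?_
    change (e.e (Q.t a)).symm _ = (e.e (Q.t a)).symm _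
    congr 1
    funext j
    change (Xi j).map a (Pi.single (M := fun i => (Xi i).space (Q.s a)) i x j) =
      Pi.single (M := fun i => (Xi i).space (Q.t a)) i ((Xi i).map a x) j
    by_cases hj : j = i
    · subst hj; simp
    · simp [Pi.single_eq_of_ne hj]
  · intro i a x
    exact (congrFun (e.comm a x) i).symm
  · intro v x
    apply (e.e v).injective
    rw [map_sum]
    have : ∀ i, e.e v (inc i v (pr i v x)) =
        Pi.single (M := fun i => (Xi i).space v) i ((e.e v x : ∀ i, (Xi i).space v) i) := by
      intro i
      exact (e.e v).apply_symm_apply _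
    rw [Finset.sum_congr rfl fun i _ => this i]
    exact Finset.univ_sum_single (M := fun i => (Xi i).space v) (e.e v x)

theorem hom_zero {Fcl Tcl : Repn k Q → Prop} (hFT : SplitTorsionPair Fcl Tcl)
    {M N : Repn k Q} (hM : M.FinDim) (hN : N.FinDim) (hMt : InAdd Tcl M) (hNf : InAdd Fcl N)
    (f : ∀ v, M.space v →ₗ[k] N.space v) (hf : IsHom M N f) (v : Q.V) (x : M.space v) :
    f v x = 0 := by
  obtain ⟨ι, hι, Xi, inc, pr, hP, hfin, hinc, hpr, hsum⟩ := inAdd_data hM hMt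
  obtain ⟨κ, hκ, Yi, inc', pr', hP', hfin', hinc', hpr', hsum'⟩ := inAdd_data hN hNf
  have key : ∀ i j v y, pr' j v (f v (inc i v y)) = 0 := by
    intro i j v y
    let g : ∀ v, (Xi i).space v →ₗ[k] (Yi j).space v := fun v =>
      (pr' j v).comp ((f v).comp (inc i v))
    have hg : g ∈ LinearMap.ker (extMap (Xi i) (Yi j)) := by
      rw [mem_ker_iff]
      intro a x
      change (Yi j).map a (pr' j _ (f _ (inc i _ x))) = pr' j _ (f _ (inc i _ _))
      rw [hpr', hf, hinc]
    have := hfin i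
    have := hfin' j
    have : ∀ v, FiniteDimensional k ((Xi i).space v) := hfin i
    have : ∀ v, FiniteDimensional k ((Yi j).space v) := hfin' j
    have h0 := hFT.2.2.1 (Xi i) (Yi j) (hP i) (hP' j)
    have hbot : LinearMap.ker (extMap (Xi i) (Yi j)) = ⊥ := Submodule.finrank_eq_zero.mp h0
    rw [hbot, Submodule.mem_bot] at hg
    exact congrArg (fun l => l y) (congrFun hg v)
  rw [← hsum' v (f v x)]
  refine Finset.sum_eq_zero fun j _ => ?_
  rw [← hsum v x, map_sum, map_sum, Finset.sum_eq_zero fun i _ => key i j v _, map_zero]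

theorem ext_surj {Fcl Tcl : Repn k Q → Prop} (hFT : SplitTorsionPair Fcl Tcl)
    {M N : Repn k Q} (hM : M.FinDim) (hN : N.FinDim) (hMf : InAdd Fcl M) (hNt : InAdd Tcl N) :
    Function.Surjective (extMap M N) := by
  obtain ⟨ι, hι, Xi, inc, pr, hP, hfin, hinc, hpr, hsum⟩ := inAdd_data hM hMf
  obtain ⟨κ, hκ, Yi, inc', pr', hP', hfin', hinc', hpr', hsum'⟩ := inAdd_data hN hNt
  have hs : ∀ i j, Function.Surjective (extMap (Xi i) (Yi j)) := by
    intro i j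
    have : ∀ v, FiniteDimensional k ((Xi i).space v) := hfin i
    have : ∀ v, FiniteDimensional k ((Yi j).space v) := hfin' j
    have h0 := hFT.2.2.2 (Xi i) (Yi j) (hP i) (hP' j)
    have h1 := Module.finrank_zero_iff.mp h0
    rw [Submodule.Quotient.subsingleton_iff] at h1
    exact LinearMap.range_eq_top.mp h1
  intro g
  have hc : ∀ i j, ∃ h, extMap (Xi i) (Yi j) h =
      fun a => (pr' j (Q.t a)).comp ((g a).comp (inc i (Q.s a))) := fun i j => hs i j _
  choose h hh using hc
  refine ⟨fun v => ∑ i, ∑ j, (inc' j v).comp ((h i j v).comp (pr i v)), ?_⟩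
  funext a
  ext x
  rw [extMap_apply]
  simp only [LinearMap.sum_apply, LinearMap.comp_apply, map_sum]
  rw [← Finset.sum_sub_distrib]
  conv_rhs => rw [← hsum _ x, map_sum]
  refine Finset.sum_congr rfl fun i _ => ?_
  rw [← Finset.sum_sub_distrib]
  conv_rhs => rw [← hsum' _ (g a _)]
  refine Finset.sum_congr rfl fun j _ => ?_
  rw [hinc', ← hpr, ← map_sub]
  congr 1
  exact congrArg (fun l => l (pr i _ x)) (congrFun (hh i j) a)

theorem repn_finDim {X : Repn k Q} (hX : X.FinDim) (U : Subrep X) : U.repn.FinDim := fun v => by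
  have := hX v
  exact inferInstanceAs (FiniteDimensional k (U.sub v))

theorem quot_finDim {X : Repn k Q} (hX : X.FinDim) (U : Subrep X) : U.quot.FinDim := fun v => by
  have := hX v
  exact inferInstanceAs (FiniteDimensional k (X.space v ⧸ U.sub v))

theorem inAdd_iso {P : Repn k Q → Prop} {M N : Repn k Q} (e : Repn.Iso M N) (h : InAdd P N) :
    InAdd P M := by
  obtain ⟨ι, hι, Xi, hP, ⟨f⟩⟩ := h
  exact ⟨ι, hι, Xi, hP, ⟨isoTrans e f⟩⟩

/-- Vanishing of Ext splits any short exact sequence `0 → N → X → M → 0`. -/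
theorem split_general {M N X : Repn k Q}
    (i : ∀ v, N.space v →ₗ[k] X.space v) (hi : IsHom N X i) (hinj : ∀ v, Function.Injective (i v))
    (p : ∀ v, X.space v →ₗ[k] M.space v) (hp : IsHom X M p) (hsurj : ∀ v, Function.Surjective (p v))
    (hpi : ∀ v y, p v (i v y) = 0) (hex : ∀ v x, p v x = 0 → ∃ y, i v y = x)
    (hs : Function.Surjective (extMap M N)) :
    Nonempty (Repn.Iso (M.dsum N) X) := by
  have h1 : ∀ v, ∃ σ : M.space v →ₗ[k] X.space v, (p v).comp σ = LinearMap.id := fun v =>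
    LinearMap.exists_rightInverse_of_surjective _ (LinearMap.range_eq_top.mpr (hsurj v))
  choose σ hσ using h1
  have hσ' : ∀ v x, p v (σ v x) = x := fun v x => congrArg (fun l => l x) (hσ v)
  have h2 : ∀ a, ∃ g : M.space (Q.s a) →ₗ[k] N.space (Q.t a),
      ∀ x, i _ (g x) = X.map a (σ _ x) - σ _ (M.map a x) := by
    intro a
    let d : M.space (Q.s a) →ₗ[k] X.space (Q.t a) :=
      (X.map a).comp (σ (Q.s a)) - (σ (Q.t a)).comp (M.map a)
    have hd : ∀ x, d x ∈ LinearMap.range (i (Q.t a)) := by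
      intro x
      apply hex
      change p _ (X.map a (σ _ x) - σ _ (M.map a x)) = 0
      rw [map_sub, hσ', ← hp, hσ', sub_self]
    refine ⟨(LinearEquiv.ofInjective (i (Q.t a)) (hinj _)).symm.toLinearMap.comp
      (LinearMap.codRestrict _ d hd), fun x => ?_⟩
    have := LinearEquiv.apply_symm_apply (LinearEquiv.ofInjective (i (Q.t a)) (hinj _))
      (LinearMap.codRestrict _ d hd x)
    exact congrArg Subtype.val this
  choose g hg using h2
  obtain ⟨h, hh⟩ := hs g
  have hh' : ∀ a x, N.map a (h _ x) - h _ (M.map a x) = g a x := fun a x =>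
    congrArg (fun l => l x) (congrFun hh a)
  let φ : ∀ v, (M.space v × N.space v) →ₗ[k] X.space v := fun v =>
    LinearMap.coprod (σ v - (i v).comp (h v)) (i v)
  have hφ : ∀ v m n, φ v (m, n) = σ v m - i v (h v m) + i v n := fun v m n => by simp [φ]
  have hb : ∀ v, Function.Bijective (φ v) := by
    intro v
    constructor
    · rw [injective_iff_map_eq_zero]
      rintro ⟨m, n⟩ h0
      rw [hφ] at h0
      have h1 := congrArg (p v) h0
      rw [map_add, map_sub, hσ', hpi, hpi, map_zero, sub_zero, add_zero] at h1
      subst h1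
      rw [map_zero, map_zero, map_zero, sub_zero, zero_add] at h0
      rw [(map_eq_zero_iff _ (hinj v)).mp h0]
      rfl
    · intro x
      obtain ⟨y, hy⟩ := hex v (x - σ v (p v x)) (by rw [map_sub, hσ', sub_self])
      refine ⟨(p v x, y + h v (p v x)), ?_⟩
      rw [hφ, map_add, hy]
      abel
  refine ⟨⟨fun v => LinearEquiv.ofBijective (φ v) (hb v), ?_⟩⟩
  rintro a ⟨m, n⟩
  change φ _ (M.map a m, N.map a n) = X.map a (φ _ (m, n))
  rw [hφ, hφ, map_add, map_sub, hi, hi]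
  have e1 := hg a m
  rw [← hh' a m, map_sub] at e1
  congr 1
  rw [sub_eq_sub_iff_add_eq_add]
  rw [sub_eq_sub_iff_add_eq_add] at e1
  rw [add_comm, e1]

theorem split_iso {X : Repn k Q} (U : Subrep X)
    (hs : Function.Surjective (extMap U.quot U.repn)) :
    Nonempty (Repn.Iso (U.quot.dsum U.repn) X) := by
  refine split_general (M := U.quot) (N := U.repn) (fun v => (U.sub v).subtype)
    (fun a x => rfl) (fun v => Subtype.val_injective) (fun v => (U.sub v).mkQ)
    (fun a x => rfl) (fun v => Submodule.mkQ_surjective _) ?_ ?_ hs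
  · intro v y
    exact (Submodule.Quotient.mk_eq_zero (U.sub v)).mpr y.2
  · intro v x hx
    exact ⟨⟨x, (Submodule.Quotient.mk_eq_zero (U.sub v)).mp hx⟩, rfl⟩

/-- Transport of subrepresentations along an isomorphism. -/
def comapSub {E X : Repn k Q} (e : Repn.Iso E X) (U : Subrep X) : Subrep E where
  sub v := (U.sub v).comap (e.e v).toLinearMap
  stable a := by
    rintro _ ⟨x, hx, rfl⟩
    change e.e (Q.t a) (E.map a x) ∈ U.sub (Q.t a)
    rw [e.comm]
    exact U.stable a (Submodule.mem_map_of_mem hx)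

theorem comapSub_repn {E X : Repn k Q} (e : Repn.Iso E X) (U : Subrep X) :
    Nonempty (Repn.Iso (comapSub e U).repn U.repn) := by
  refine ⟨⟨fun v => (e.e v).ofSubmodule' (U.sub v), ?_⟩⟩
  intro a x
  exact Subtype.ext (e.comm a _)

theorem comapSub_quot {E X : Repn k Q} (e : Repn.Iso E X) (U : Subrep X) :
    Nonempty (Repn.Iso (comapSub e U).quot U.quot) := by
  refine ⟨⟨fun v => Submodule.Quotient.equiv ((comapSub e U).sub v) (U.sub v) (e.e v)
    (Submodule.map_comap_eq_of_surjective (e.e v).surjective _), ?_⟩⟩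
  intro a x
  obtain ⟨y, rfl⟩ := Submodule.Quotient.mk_surjective _ x
  exact congrArg (Submodule.Quotient.mk (p := U.sub (Q.t a))) (e.comm a y)

theorem subrep_ext {X : Repn k Q} {U V : Subrep X} (h : ∀ v, U.sub v = V.sub v) : U = V := by
  cases U; cases V
  congr 1
  exact funext h

/-- A torsion submodule is contained in the kernel of any map to a torsion-free quotient. -/
theorem sub_le {Fcl Tcl : Repn k Q → Prop} (hFT : SplitTorsionPair Fcl Tcl)
    {X : Repn k Q} (hX : X.FinDim) (U V : Subrep X) (hU : InAdd Tcl U.repn)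
    (hV : InAdd Fcl V.quot) (v : Q.V) : U.sub v ≤ V.sub v := by
  intro x hx
  have := hom_zero hFT (repn_finDim hX U) (quot_finDim hX V) hU hV
    (fun v => (V.sub v).mkQ.comp (U.sub v).subtype) (fun a x => rfl) v ⟨x, hx⟩
  exact (Submodule.Quotient.mk_eq_zero (V.sub v)).mp this

/-- Lower triangular automorphism. -/
def triIso (M N : Repn k Q)
    (p : Repn.Iso M M × Repn.Iso N N × LinearMap.ker (extMap M N)) :
    Repn.Iso (M.dsum N) (M.dsum N) where
  e v := LinearEquiv.skewProd (p.1.e v) (p.2.1.e v) (p.2.2.1 v)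
  comm a x := by
    refine Prod.ext (p.1.comm a x.1) ?_
    have h := (mem_ker_iff M N _).mp p.2.2.2 a x.1
    change p.2.1.e _ (N.map a x.2) + p.2.2.1 _ (M.map a x.1) =
      N.map a (p.2.1.e _ x.2 + p.2.2.1 _ x.1)
    rw [map_add, p.2.1.comm, h]

theorem triIso_bij (M N : Repn k Q)
    (h0 : ∀ f, IsHom N M f → ∀ v x, f v x = 0) : Function.Bijective (triIso M N) := by
  have hz : ∀ (e : Repn.Iso (M.dsum N) (M.dsum N)) v (n : N.space v), (e.e v (0, n)).1 = 0 := by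
    intro e
    refine h0 (fun v => (LinearMap.fst k _ _).comp
      ((e.e v).toLinearMap.comp (LinearMap.inr k _ _))) ?_
    intro a x
    have := e.comm a ((0, x) : M.space _ × N.space _)
    have h2 := congrArg Prod.fst this
    refine h2.symm.trans ?_
    change (e.e _ (M.map a 0, N.map a x)).1 = _
    rw [map_zero]
    rfl
  have hdec : ∀ v (m : M.space v) (n : N.space v),
      (m, n) = ((m, 0) + (0, n) : M.space v × N.space v) := by
    intro v m n; simp
  have hfst : ∀ (e : Repn.Iso (M.dsum N) (M.dsum N)) v (m : M.space v) (n : N.space v),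
      (e.e v (m, n)).1 = (e.e v (m, 0)).1 := by
    intro e v m n
    have h1 : e.e v (m, n) = e.e v (m, 0) + e.e v (0, n) := by
      rw [hdec v m n]; exact map_add (e.e v) _ _
    rw [h1]
    change (e.e v (m, 0)).1 + (e.e v (0, n)).1 = _
    rw [hz, add_zero]
  constructor
  · rintro ⟨α, β, γ⟩ ⟨α', β', γ'⟩ h
    have hv : ∀ v (m : M.space v) (n : N.space v),
        (α.e v m, β.e v n + γ.1 v m) = (α'.e v m, β'.e v n + γ'.1 v m) := fun v m n =>
      congrArg (fun (e : Repn.Iso (M.dsum N) (M.dsum N)) => e.e v (m, n)) h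
    have h1 : α = α' := iso_ext fun v x => congrArg Prod.fst (hv v x 0)
    have h2 : β = β' := iso_ext fun v x => by
      have := congrArg Prod.snd (hv v 0 x)
      simpa using this
    have h3 : γ = γ' := Subtype.ext (funext fun v => LinearMap.ext fun x => by
      have := congrArg Prod.snd (hv v x 0)
      simpa using this)
    rw [h1, h2, h3]
  · intro e
    have hsym : ∀ v (x : M.space v × N.space v), e.e v ((isoSymm e).e v x) = x :=
      fun v x => (e.e v).apply_symm_apply x
    have hsym' : ∀ v (x : M.space v × N.space v), (isoSymm e).e v (e.e v x) = x :=
      fun v x => (e.e v).symm_apply_apply x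
    have ha : ∀ (e f : Repn.Iso (M.dsum N) (M.dsum N)),
        (∀ v (x : M.space v × N.space v), e.e v (f.e v x) = x) →
        ∀ v (m : M.space v), (e.e v ((f.e v (m, 0)).1, 0)).1 = m := by
      intro e f h v m
      rw [← hfst e v _ (f.e v (m, 0)).2]
      exact congrArg Prod.fst (h v (m, 0))
    have hd : ∀ (e f : Repn.Iso (M.dsum N) (M.dsum N)),
        (∀ v (x : M.space v × N.space v), e.e v (f.e v x) = x) →
        ∀ v (n : N.space v), (e.e v (0, (f.e v (0, n)).2)).2 = n := by
      intro e f h v n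
      have h2 := congrArg Prod.snd (h v (0, n))
      refine Eq.trans ?_ h2
      congr 2
      exact Prod.ext (hz f v n).symm rfl
    let α : Repn.Iso M M :=
      { e := fun v => LinearEquiv.ofLinearMap
          ((LinearMap.fst k _ _).comp ((e.e v).toLinearMap.comp (LinearMap.inl k _ _)))
          ((LinearMap.fst k _ _).comp (((isoSymm e).e v).toLinearMap.comp (LinearMap.inl k _ _)))
          (LinearMap.ext fun m => ha e (isoSymm e) hsym v m)
          (LinearMap.ext fun m => ha (isoSymm e) e hsym' v m)
        comm := fun a x => by
          have := congrArg Prod.fst (e.comm a ((x, 0) : M.space _ × N.space _))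
          refine Eq.trans ?_ this
          change _ = (e.e _ (M.map a x, N.map a 0)).1
          rw [map_zero]
          rfl }
    let β : Repn.Iso N N :=
      { e := fun v => LinearEquiv.ofLinearMap
          ((LinearMap.snd k _ _).comp ((e.e v).toLinearMap.comp (LinearMap.inr k _ _)))
          ((LinearMap.snd k _ _).comp (((isoSymm e).e v).toLinearMap.comp (LinearMap.inr k _ _)))
          (LinearMap.ext fun m => hd e (isoSymm e) hsym v m)
          (LinearMap.ext fun m => hd (isoSymm e) e hsym' v m)
        comm := fun a x => by
          have := congrArg Prod.snd (e.comm a ((0, x) : M.space _ × N.space _))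
          refine Eq.trans ?_ this
          change _ = (e.e _ (M.map a 0, N.map a x)).2
          rw [map_zero]
          rfl }
    let γ : LinearMap.ker (extMap M N) :=
      ⟨fun v => (LinearMap.snd k _ _).comp ((e.e v).toLinearMap.comp (LinearMap.inl k _ _)), by
        rw [mem_ker_iff]
        intro a x
        have := congrArg Prod.snd (e.comm a ((x, 0) : M.space _ × N.space _))
        refine Eq.trans this.symm ?_
        change (e.e _ (M.map a x, N.map a 0)).2 = _
        rw [map_zero]
        rfl⟩
    refine ⟨(α, β, γ), iso_ext ?_⟩
    rintro v ⟨m, n⟩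
    refine Prod.ext (hfst e v m n).symm ?_
    have h1 : e.e v (m, n) = e.e v (m, 0) + e.e v (0, n) := by
      have : ((m, n) : M.space v × N.space v) = (m, 0) + (0, n) := hdec v m n
      exact (congrArg (e.e v) this).trans (map_add (e.e v) _ _)
    rw [h1]
    exact add_comm (e.e v (0, n)).2 (e.e v (m, 0)).2

theorem autCard_iso {M N : Repn k Q} (e : Repn.Iso M N) : autCard M = autCard N := by
  refine Nat.card_congr ⟨fun f => isoTrans (isoSymm e) (isoTrans f e),
    fun f => isoTrans e (isoTrans f (isoSymm e)), ?_, ?_⟩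
  · intro f
    refine iso_ext fun v x => ?_
    simp [isoTrans, isoSymm]
  · intro f
    refine iso_ext fun v x => ?_
    simp [isoTrans, isoSymm]

theorem homDim_eq {M N : Repn k Q} (hM : M.FinDim) (hN : N.FinDim)
    (hs : Function.Surjective (extMap M N)) :
    (homDim M N : ℤ) = eulerZ Q (natc M.dimv) (natc N.dimv) := by
  have : ∀ v, FiniteDimensional k (M.space v) := hM
  have : ∀ v, FiniteDimensional k (N.space v) := hN
  have h := LinearMap.finrank_range_add_finrank_ker (extMap M N)
  rw [LinearMap.range_eq_top.mpr hs, finrank_top, Module.finrank_pi_fintype,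
    Module.finrank_pi_fintype] at h
  simp only [Module.finrank_linearMap] at h
  unfold homDim eulerZ natc Repn.dimv
  rw [eq_sub_iff_add_eq, add_comm]
  exact_mod_cast h

end STP

/-- **Basic facts about split torsion pairs** (Section 2 of the paper).  Let `(F,T)` be
a split torsion pair, `X` a module with torsion part `X_t` and torsion-free part
`X_f = X/X_t`.  Then `F_{X_f X_t}^E` is `1` for `E ≅ X` and `0` otherwise, and
`|Aut X| = |Aut X_f| ⋅ |Aut X_t| ⋅ q^{⟨X_f, X_t⟩}`. -/
theorem split_torsion_pair_hall_and_aut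
    (Q : QuiverData) (k : Type) [Field k] [Fintype k]
    (Fcl Tcl : Repn k Q → Prop) (hFT : SplitTorsionPair Fcl Tcl)
    (X : Repn k Q) (hX : X.FinDim)
    (U : Subrep X) (hUt : InAdd Tcl U.repn) (hUf : InAdd Fcl U.quot) :
    (∀ E : Repn k Q, E.FinDim →
      (Nonempty (Repn.Iso E X) → hallNum U.quot U.repn E = 1) ∧
      (¬ Nonempty (Repn.Iso E X) → hallNum U.quot U.repn E = 0)) ∧
    (autCard X : ℚ) = (autCard U.quot : ℚ) * (autCard U.repn : ℚ) *
      (Fintype.card k : ℚ) ^ (eulerZ Q (natc (Repn.dimv U.quot)) (natc (Repn.dimv U.repn))) := by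
  classical
  have hsU := STP.ext_surj hFT (STP.quot_finDim hX U) (STP.repn_finDim hX U) hUf hUt
  obtain ⟨eX⟩ := STP.split_iso U hsU
  refine ⟨fun E hE => ⟨?_, ?_⟩, ?_⟩
  · rintro ⟨e⟩
    unfold hallNum
    rw [Nat.card_eq_one_iff_unique]
    refine ⟨⟨?_⟩, ⟨⟨STP.comapSub e U, STP.comapSub_repn e U, STP.comapSub_quot e U⟩⟩⟩
    rintro ⟨V, ⟨v1⟩, ⟨v2⟩⟩ ⟨W, ⟨w1⟩, ⟨w2⟩⟩
    refine Subtype.ext (STP.subrep_ext fun v => le_antisymm ?_ ?_)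
    · exact STP.sub_le hFT hE V W (STP.inAdd_iso v1 hUt) (STP.inAdd_iso w2 hUf) v
    · exact STP.sub_le hFT hE W V (STP.inAdd_iso w1 hUt) (STP.inAdd_iso v2 hUf) v
  · intro hne
    unfold hallNum
    have : IsEmpty {V : Subrep E // Nonempty (Repn.Iso V.repn U.repn) ∧
        Nonempty (Repn.Iso V.quot U.quot)} := by
      refine ⟨?_⟩
      rintro ⟨V, ⟨v1⟩, ⟨v2⟩⟩
      obtain ⟨eE⟩ := STP.split_iso V (STP.ext_surj hFT (STP.quot_finDim hE V)
        (STP.repn_finDim hE V) (STP.inAdd_iso v2 hUf) (STP.inAdd_iso v1 hUt))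
      exact hne ⟨STP.isoTrans (STP.isoSymm eE) (STP.isoTrans (STP.isoDsum v2 v1) eX)⟩
    exact Nat.card_of_isEmpty
  · have : ∀ v, FiniteDimensional k (U.quot.space v) := STP.quot_finDim hX U
    have : ∀ v, FiniteDimensional k (U.repn.space v) := STP.repn_finDim hX U
    rw [← STP.homDim_eq (STP.quot_finDim hX U) (STP.repn_finDim hX U) hsU, zpow_natCast,
      ← STP.autCard_iso eX]
    have h0 := STP.hom_zero hFT (STP.repn_finDim hX U) (STP.quot_finDim hX U) hUt hUf
    have hc := Nat.card_congr (Equiv.ofBijective _ (STP.triIso_bij U.quot U.repn h0))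
    rw [Nat.card_prod, Nat.card_prod, Module.natCard_eq_pow_finrank (K := k)
        (V := LinearMap.ker (extMap U.quot U.repn)),
      Nat.card_eq_fintype_card (α := k)] at hc
    unfold autCard homDim
    rw [← hc]
    push_cast
    ring
end
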